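/- arXiv:1102.1136 — 3 statements merged into one kernel-verified Lean document; each statement's English description precedes it below -/
import Mathlib

section
/- Let K ≥ 1 and let φ : [0,+∞] → [0,+∞] be a strictly increasing function such that for some natural numbers s₀ < s₁ one has ∫_{s₁}^{+∞} ds/(φ(s-s₀))^{1/(n-1)} < +∞. Let F_K : D → [0,+∞] be Lebesgue measurable and let 𝓕_K be a family of K-quasinearly subharmonic functions u : D → [-∞,+∞) such that u(x) ≤ F_K(x) for all x ∈ D. Let p > 0 be arbitrary. If for each compact set E ⊂ D one has ∫_E φ(log⁺ (F_K(x))^p) dm_n(x) < +∞, then the family 𝓕_K is locally uniformly bounded in D, and the function w*(x) := limsup_{y→x} w(y), where w(x) := sup_{u ∈ 𝓕_K} u⁺(x), is a K-quasinearly subharmonic function on D (with finite values). -/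
open MeasureTheory Metric Filter Set ENNReal

noncomputable section

/-- The positive part of an extended real number, as an element of `ℝ≥0∞`. -/
def erealPos (x : EReal) : ℝ≥0∞ := if x = ⊤ then ⊤ else ENNReal.ofReal x.toReal

/-- `ν_n`, the Lebesgue measure of the unit ball of `ℝⁿ`. -/
def nuBall (n : ℕ) : ℝ := (volume (Metric.ball (0 : EuclideanSpace ℝ (Fin n)) 1)).toReal

/-- The (upper) integral `∫_A u dm_n` of an `EReal`-valued function, defined as the
lintegral of the positive part minus the lintegral of the negative part (an `EReal`). -/
def erealIntegralOn {n : ℕ} (A : Set (EuclideanSpace ℝ (Fin n)))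
    (u : EuclideanSpace ℝ (Fin n) → EReal) : EReal :=
  ((∫⁻ y in A, erealPos (u y) : ℝ≥0∞) : EReal) - ((∫⁻ y in A, erealPos (-(u y)) : ℝ≥0∞) : EReal)

/-- `u⁺ ∈ L¹_loc(D)`: the positive part of `u` has finite integral over every
compact subset of `D`. -/
def PosPartLocInt {n : ℕ} (u : EuclideanSpace ℝ (Fin n) → EReal)
    (D : Set (EuclideanSpace ℝ (Fin n))) : Prop :=
  ∀ E ⊆ D, IsCompact E → ∫⁻ x in E, erealPos (u x) < ⊤

/-- `u : D → [-∞, +∞)` is subharmonic on `D`: upper semicontinuous on `D`, never `+∞` on `D`,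
and satisfying the sub-mean-value inequality on every closed ball contained in `D`.
(The function `≡ -∞` satisfies this definition.) -/
def SubharmonicOn {n : ℕ} (u : EuclideanSpace ℝ (Fin n) → EReal)
    (D : Set (EuclideanSpace ℝ (Fin n))) : Prop :=
  UpperSemicontinuousOn u D ∧ (∀ x ∈ D, u x < ⊤) ∧
  ∀ x r, 0 < r → closedBall x r ⊆ D →
    u x ≤ ((1 / (nuBall n * r ^ n) : ℝ) : EReal) * erealIntegralOn (ball x r) u

/-- `u : D → [-∞, +∞)` is nearly subharmonic on `D`. -/
def NearlySubharmonicOn {n : ℕ} (u : EuclideanSpace ℝ (Fin n) → EReal)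
    (D : Set (EuclideanSpace ℝ (Fin n))) : Prop :=
  Measurable (D.restrict u) ∧ (∀ x ∈ D, u x < ⊤) ∧ PosPartLocInt u D ∧
  ∀ x r, 0 < r → closedBall x r ⊆ D →
    u x ≤ ((1 / (nuBall n * r ^ n) : ℝ) : EReal) * erealIntegralOn (ball x r) u

/-- `u : D → [-∞, +∞)` is `K`-quasinearly subharmonic on `D`:
Lebesgue measurable, `u⁺ ∈ L¹_loc(D)`, and for every `M ≥ 0` the function
`u_M := max {u, -M} + M` satisfies the generalized sub-mean-value inequality with constant `K`
on every closed ball contained in `D`. -/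
def QNSubharmonicOn {n : ℕ} (K : ℝ) (u : EuclideanSpace ℝ (Fin n) → EReal)
    (D : Set (EuclideanSpace ℝ (Fin n))) : Prop :=
  Measurable (D.restrict u) ∧ (∀ x ∈ D, u x < ⊤) ∧ PosPartLocInt u D ∧
  ∀ M : ℝ, 0 ≤ M → ∀ x r, 0 < r → closedBall x r ⊆ D →
    erealPos ((u x ⊔ ((-M : ℝ) : EReal)) + ((M : ℝ) : EReal)) ≤
      ENNReal.ofReal (K / (nuBall n * r ^ n)) *
        ∫⁻ y in ball x r, erealPos ((u y ⊔ ((-M : ℝ) : EReal)) + ((M : ℝ) : EReal))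

/-- `u : D → [-∞, +∞)` is `K`-quasinearly subharmonic n.s. (in the narrow sense) on `D`. -/
def QNSubharmonicNSOn {n : ℕ} (K : ℝ) (u : EuclideanSpace ℝ (Fin n) → EReal)
    (D : Set (EuclideanSpace ℝ (Fin n))) : Prop :=
  Measurable (D.restrict u) ∧ (∀ x ∈ D, u x < ⊤) ∧ PosPartLocInt u D ∧
  ∀ x r, 0 < r → closedBall x r ⊆ D →
    u x ≤ ((K / (nuBall n * r ^ n) : ℝ) : EReal) * erealIntegralOn (ball x r) u

/-- `log⁺` on `[0, +∞]`. -/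
def logPlusE (t : ℝ≥0∞) : ℝ≥0∞ := if t = ⊤ then ⊤ else ENNReal.ofReal (Real.log t.toReal)

lemma nuBall_pos (n : ℕ) : 0 < nuBall n :=
  ENNReal.toReal_pos (measure_ball_pos volume _ one_pos).ne' measure_ball_lt_top.ne

lemma ofReal_nuBall (n : ℕ) :
    ENNReal.ofReal (nuBall n) = volume (ball (0 : EuclideanSpace ℝ (Fin n)) 1) :=
  ENNReal.ofReal_toReal measure_ball_lt_top.ne

/-- The normalising factor of the generalized mean value inequality. -/
lemma ofReal_div_nuBall {n : ℕ} {K r : ℝ} (hr : 0 < r) :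
    ENNReal.ofReal (K / (nuBall n * r ^ n)) =
      ENNReal.ofReal K / (ENNReal.ofReal (nuBall n) * ENNReal.ofReal r ^ n) := by
  have := nuBall_pos n
  rw [ENNReal.ofReal_div_of_pos (by positivity), ENNReal.ofReal_mul this.le,
    ENNReal.ofReal_pow hr.le]

lemma ofReal_div_nuBall_mul_volume {n : ℕ} {K r : ℝ} (hr : 0 < r)
    (x : EuclideanSpace ℝ (Fin n)) :
    ENNReal.ofReal (K / (nuBall n * r ^ n)) * volume (ball x r) = ENNReal.ofReal K := by
  have hv := nuBall_pos n
  rw [Measure.addHaar_ball_of_pos _ _ hr, finrank_euclideanSpace_fin, ← ofReal_nuBall,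
    ← ENNReal.ofReal_mul (by positivity), mul_comm (r ^ n),
    ← ENNReal.ofReal_mul' (by positivity), div_mul_cancel₀ _ (by positivity)]

/-- If the generalized mean value inequality holds at `x` and the set where `v` lies between
`a` and `q * t` is small compared to the ball, then `v` exceeds `q * t` on that ball. -/
lemma exists_lt_of_volume_le {n : ℕ} {K : ℝ} {v : EuclideanSpace ℝ (Fin n) → ℝ≥0∞}
    (hv : Measurable v) {x : EuclideanSpace ℝ (Fin n)} {r : ℝ} (hr : 0 < r)
    (hmean : v x ≤ ENNReal.ofReal (K / (nuBall n * r ^ n)) * ∫⁻ y in ball x r, v y)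
    {a q t : ℝ≥0∞} (ha : 2 * ENNReal.ofReal K * a ≤ t) (hx : t < v x)
    (hvol : 2 * ENNReal.ofReal K * q / ENNReal.ofReal (nuBall n) *
      volume (ball x r ∩ {y | a < v y ∧ v y ≤ q * t}) ≤ ENNReal.ofReal r ^ n) :
    ∃ y ∈ ball x r, q * t < v y := by
  by_contra! hle
  set S := {y | a < v y ∧ v y ≤ q * t} with hSdef
  have hS : MeasurableSet S :=
    (measurableSet_lt measurable_const hv).inter (measurableSet_le hv measurable_const)
  set c := ENNReal.ofReal (K / (nuBall n * r ^ n)) with hc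
  have hint : ∫⁻ y in ball x r, v y ≤ a * volume (ball x r) + q * t * volume (ball x r ∩ S) := by
    calc ∫⁻ y in ball x r, v y
        ≤ ∫⁻ y in ball x r, (a + S.indicator (fun _ => q * t) y) := by
          refine setLIntegral_mono' measurableSet_ball fun y hy => ?_
          by_cases hay : a < v y
          · have : y ∈ S := ⟨hay, hle y hy⟩
            rw [Set.indicator_of_mem this]
            exact (hle y hy).trans le_add_self
          · exact (not_lt.1 hay).trans le_self_add
      _ = a * volume (ball x r) + q * t * volume (ball x r ∩ S) := by
          rw [lintegral_add_left measurable_const, setLIntegral_const,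
            lintegral_indicator_const hS, Measure.restrict_apply hS, Set.inter_comm]
  have hr0 : ENNReal.ofReal r ^ n ≠ 0 := by
    simp [hr]
  have hrt : ENNReal.ofReal r ^ n ≠ ⊤ := by simp
  have hsmall : 2 * (c * q * volume (ball x r ∩ S)) ≤ 1 := by
    have hn0 : ENNReal.ofReal (nuBall n) ≠ 0 := by simp [nuBall_pos]
    calc 2 * (c * q * volume (ball x r ∩ S))
        = 2 * ENNReal.ofReal K * q / ENNReal.ofReal (nuBall n) * volume (ball x r ∩ S) *
            (ENNReal.ofReal r ^ n)⁻¹ := by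
          rw [hc, ofReal_div_nuBall hr, div_eq_mul_inv, div_eq_mul_inv,
            ENNReal.mul_inv (Or.inl hn0) (Or.inl ENNReal.ofReal_ne_top)]
          ring
      _ ≤ ENNReal.ofReal r ^ n * (ENNReal.ofReal r ^ n)⁻¹ := by gcongr
      _ = 1 := ENNReal.mul_inv_cancel hr0 hrt
  have hfin : 2 * v x ≤ 2 * t := by
    calc 2 * v x ≤ 2 * (c * (a * volume (ball x r) + q * t * volume (ball x r ∩ S))) := by
          gcongr; exact hmean.trans (by gcongr)
      _ = 2 * (c * volume (ball x r)) * a + 2 * (c * q * volume (ball x r ∩ S)) * t := by ring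
      _ = 2 * ENNReal.ofReal K * a + 2 * (c * q * volume (ball x r ∩ S)) * t := by
          rw [hc, ofReal_div_nuBall_mul_volume hr]
      _ ≤ t + 1 * t := by gcongr
      _ = 2 * t := by ring
  exact absurd hx (not_lt.2 ((ENNReal.mul_le_mul_iff_right two_ne_zero ofNat_ne_top).1 hfin))

/-- Layer-cake estimate for overlapping geometric layers of `v`. -/
lemma tsum_mul_volume_layer_le {α : Type*} [MeasurableSpace α] {μ : Measure α}
    {v G : α → ℝ≥0∞} (hv : Measurable v) {E : Set α} (hE : MeasurableSet E)
    {q : ℝ≥0∞} (hq : 1 ≤ q) {ψ : ℕ → ℝ≥0∞} (hψ : Monotone ψ)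
    (hG : ∀ y ∈ E, ∀ j, q ^ j < v y → ψ j ≤ G y) (N : ℕ) :
    ∑' j, ψ j * μ (E ∩ {y | q ^ j < v y ∧ v y ≤ q ^ (j + N)}) ≤ N * ∫⁻ y in E, G y ∂μ := by
  set A : ℕ → Set α := fun j => E ∩ {y | q ^ j < v y ∧ v y ≤ q ^ (j + 1)} with hA
  have hmono : Monotone fun j : ℕ => q ^ j := pow_right_mono₀ hq
  have hAmeas : ∀ j, MeasurableSet (A j) := fun j => hE.inter
    ((measurableSet_lt measurable_const hv).inter (measurableSet_le hv measurable_const))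
  have hdisj : Pairwise (Function.onFun Disjoint A) := by
    refine (pairwise_disjoint_on A).2 fun i j hij => ?_
    refine Set.disjoint_left.2 fun y hi hj => ?_
    exact absurd (hj.2.1.trans_le hi.2.2) (not_lt.2 (hmono (Nat.succ_le_of_lt hij)))
  have hsingle : ∑' j, ψ j * μ (A j) ≤ ∫⁻ y in E, G y ∂μ := by
    calc ∑' j, ψ j * μ (A j) = ∑' j, ∫⁻ _ in A j, ψ j ∂μ := by simp
      _ ≤ ∑' j, ∫⁻ y in A j, G y ∂μ := ENNReal.tsum_le_tsum fun j =>
          setLIntegral_mono' (hAmeas j) fun y hy => hG y hy.1 j hy.2.1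
      _ = ∫⁻ y in ⋃ j, A j, G y ∂μ := (lintegral_iUnion hAmeas hdisj _).symm
      _ ≤ ∫⁻ y in E, G y ∂μ :=
          lintegral_mono_set (Set.iUnion_subset fun j => Set.inter_subset_left)
  have hcover : ∀ j, E ∩ {y | q ^ j < v y ∧ v y ≤ q ^ (j + N)} ⊆
      ⋃ i ∈ Finset.range N, A (j + i) := by
    intro j
    induction N with
    | zero => rintro y ⟨-, h1, h2⟩; exact absurd h1 (not_lt.2 h2)
    | succ N ih =>
      rintro y ⟨hy, h1, h2⟩
      by_cases h : v y ≤ q ^ (j + N)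
      · obtain ⟨i, hi, hyi⟩ := Set.mem_iUnion₂.1 (ih ⟨hy, h1, h⟩)
        exact Set.mem_iUnion₂.2 ⟨i, Finset.mem_range.2 (by have := Finset.mem_range.1 hi; omega), hyi⟩
      · exact Set.mem_iUnion₂.2 ⟨N, Finset.self_mem_range_succ N, hy, not_le.1 h, h2⟩
  calc ∑' j, ψ j * μ (E ∩ {y | q ^ j < v y ∧ v y ≤ q ^ (j + N)})
      ≤ ∑' j, ∑ i ∈ Finset.range N, ψ (j + i) * μ (A (j + i)) := by
        refine ENNReal.tsum_le_tsum fun j => ?_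
        calc ψ j * μ (E ∩ {y | q ^ j < v y ∧ v y ≤ q ^ (j + N)})
            ≤ ψ j * ∑ i ∈ Finset.range N, μ (A (j + i)) := by
              gcongr
              exact (measure_mono (hcover j)).trans (measure_biUnion_finset_le _ _)
          _ ≤ _ := by
              rw [Finset.mul_sum]
              gcongr
              exact hψ (Nat.le_add_right _ _)
    _ = ∑ i ∈ Finset.range N, ∑' j, ψ (j + i) * μ (A (j + i)) :=
        Summable.tsum_finsetSum fun _ _ => ENNReal.summable
    _ ≤ ∑ _i ∈ Finset.range N, ∫⁻ y in E, G y ∂μ := by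
        gcongr with i
        exact (ENNReal.tsum_comp_le_tsum_of_injective (add_left_injective i)
          (fun j => ψ j * μ (A j))).trans hsingle
    _ = N * ∫⁻ y in E, G y ∂μ := by simp

/-- The integral condition bounds the corresponding series over the integers. -/
lemma tsum_inv_rpow_lt_top {φ : ℝ≥0∞ → ℝ≥0∞} (hφ : Monotone φ) {e : ℝ} (he : 0 ≤ e)
    {s₀ s₁ : ℕ} (hs : s₀ < s₁)
    (hiv : ∫⁻ s in Set.Ioi (s₁ : ℝ), (φ (ENNReal.ofReal (s - (s₀ : ℝ))) ^ e)⁻¹ < ⊤) :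
    ∑' k : ℕ, (φ ((k + (s₁ - s₀ + 1) : ℕ) : ℝ≥0∞) ^ e)⁻¹ < ⊤ := by
  refine lt_of_le_of_lt ?_ hiv
  set B : ℕ → Set ℝ := fun k => Set.Ioc (s₁ + k : ℝ) (s₁ + k + 1)
  have hdisj : Pairwise (Function.onFun Disjoint B) := by
    refine (pairwise_disjoint_on B).2 fun i j hij => ?_
    refine Set.disjoint_left.2 fun y hi hj => ?_
    have : (i : ℝ) + 1 ≤ j := by exact_mod_cast hij
    linarith [hi.2, hj.1]
  calc ∑' k : ℕ, (φ ((k + (s₁ - s₀ + 1) : ℕ) : ℝ≥0∞) ^ e)⁻¹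
      = ∑' k : ℕ, ∫⁻ _ in B k, (φ ((k + (s₁ - s₀ + 1) : ℕ) : ℝ≥0∞) ^ e)⁻¹ := by
        simp [B]
    _ ≤ ∑' k : ℕ, ∫⁻ s in B k, (φ (ENNReal.ofReal (s - (s₀ : ℝ))) ^ e)⁻¹ := by
        refine ENNReal.tsum_le_tsum fun k => setLIntegral_mono' measurableSet_Ioc fun s hs' => ?_
        refine ENNReal.inv_le_inv.2 (ENNReal.rpow_le_rpow (hφ ?_) he)
        rw [← ENNReal.ofReal_natCast]
        refine ENNReal.ofReal_le_ofReal ?_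
        push_cast [Nat.cast_sub hs.le]
        linarith [hs'.2]
    _ = ∫⁻ s in ⋃ k, B k, (φ (ENNReal.ofReal (s - (s₀ : ℝ))) ^ e)⁻¹ :=
        (lintegral_iUnion (fun _ => measurableSet_Ioc) hdisj _).symm
    _ ≤ _ := by
        refine lintegral_mono_set (Set.iUnion_subset fun k s hs' => ?_)
        have : (0 : ℝ) ≤ k := k.cast_nonneg
        exact lt_of_le_of_lt (by linarith) hs'.1

lemma natCast_le_logPlusE_rpow {p : ℝ} (hp : 0 < p) {j : ℕ} {t : ℝ≥0∞}
    (ht : ENNReal.ofReal (Real.exp (1 / p)) ^ j < t) : (j : ℝ≥0∞) ≤ logPlusE (t ^ p) := by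
  unfold logPlusE
  split_ifs with h
  · exact le_top
  · have htt : t ≠ ⊤ := fun h' => h (by simp [h', hp])
    rw [← ENNReal.ofReal_natCast]
    refine ENNReal.ofReal_le_ofReal ?_
    rw [← ENNReal.ofReal_pow (Real.exp_pos _).le, ← Real.exp_nat_mul,
      ENNReal.ofReal_lt_iff_lt_toReal (Real.exp_pos _).le htt] at ht
    have hpos : 0 < t.toReal := (Real.exp_pos _).trans ht
    rw [← ENNReal.toReal_rpow, Real.log_rpow hpos]
    have := (Real.lt_log_iff_exp_lt hpos).2 ht
    have h2 : p * (j * (1 / p)) = j := by field_simp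
    nlinarith

/-- Domar-type bound: if `v` satisfies the generalized mean value inequality and a weighted sum
of its layers is controlled, then `v` is bounded by a level depending only on the control. -/
lemma le_pow_of_tsum_radius_lt {n : ℕ} {K ρ : ℝ}
    {v : EuclideanSpace ℝ (Fin n) → ℝ≥0∞} (hv : Measurable v) {x₀ : EuclideanSpace ℝ (Fin n)}
    (hmean : ∀ x ∈ closedBall x₀ ρ, ∀ r, 0 < r → r ≤ ρ →
      v x ≤ ENNReal.ofReal (K / (nuBall n * r ^ n)) * ∫⁻ y in ball x r, v y)
    {E : Set (EuclideanSpace ℝ (Fin n))} (hE : closedBall x₀ (2 * ρ) ⊆ E) (hρ : 0 < ρ)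
    (hfin : ∫⁻ y in E, v y < ⊤)
    {q : ℝ≥0∞} (hq : 1 < q) {N : ℕ} (hN : 2 * ENNReal.ofReal K ≤ q ^ N)
    {R : ℕ → ℝ≥0∞} (hR0 : ∀ j, R j ≠ 0) {J : ℕ} (hR : ∑' k, R (k + J) < ENNReal.ofReal ρ)
    (hvol : ∀ j, 2 * ENNReal.ofReal K * q / ENNReal.ofReal (nuBall n) *
      volume (E ∩ {y | q ^ j < v y ∧ v y ≤ q ^ (j + (N + 1))}) ≤ R j ^ n) :
    v x₀ ≤ q ^ (J + N) := by
  by_contra! hx₀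
  have hsum : ∀ k, ∑ i ∈ Finset.range k, R (i + J) < ENNReal.ofReal ρ := fun k =>
    (ENNReal.sum_le_tsum _).trans_lt hR
  have hchain : ∀ k, ∃ x, edist x x₀ ≤ ∑ i ∈ Finset.range k, R (i + J) ∧
      q ^ (J + N + k) < v x := by
    intro k
    induction k with
    | zero => exact ⟨x₀, by simp, by simpa using hx₀⟩
    | succ k ih =>
      obtain ⟨x, hxd, hxv⟩ := ih
      have hlt := hsum (k + 1)
      rw [Finset.sum_range_succ] at hlt
      have hRlt : R (k + J) < ENNReal.ofReal ρ := lt_of_le_of_lt le_add_self hlt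
      have hRtop : R (k + J) ≠ ⊤ := hRlt.ne_top
      set r := (R (k + J)).toReal with hr
      have hofr : ENNReal.ofReal r = R (k + J) := ENNReal.ofReal_toReal hRtop
      have hrpos : 0 < r := ENNReal.toReal_pos (hR0 _) hRtop
      have hrρ : r ≤ ρ := by
        rw [← hofr] at hRlt
        exact ((ENNReal.ofReal_lt_ofReal_iff hρ).1 hRlt).le
      have hxρ : x ∈ closedBall x₀ ρ := by
        rw [mem_closedBall, ← ENNReal.ofReal_le_ofReal_iff hρ.le, ← edist_dist]
        exact hxd.trans (hsum k).le
      have hball : ball x r ⊆ E := by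
        refine subset_trans (fun y hy => ?_) hE
        have := dist_triangle y x x₀
        rw [mem_ball] at hy
        rw [mem_closedBall] at hxρ ⊢
        linarith
      obtain ⟨y, hy, hyv⟩ := exists_lt_of_volume_le (a := q ^ (k + J)) (q := q)
        (t := q ^ (J + N + k)) hv hrpos (hmean x hxρ r hrpos hrρ)
        (by
          calc 2 * ENNReal.ofReal K * q ^ (k + J) ≤ q ^ N * q ^ (k + J) := by gcongr
            _ = q ^ (J + N + k) := by rw [← pow_add]; congr 1; omega)
        hxv (by
          rw [hofr]
          refine le_trans ?_ (hvol (k + J))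
          gcongr
          rw [← pow_succ', show J + N + k + 1 = k + J + (N + 1) by omega])
      refine ⟨y, ?_, by rwa [← pow_succ'] at hyv⟩
      rw [Finset.sum_range_succ, add_comm]
      refine (edist_triangle y x x₀).trans (add_le_add ?_ hxd)
      rw [← hofr, edist_dist]
      exact ENNReal.ofReal_le_ofReal (mem_ball.1 hy).le
  set B := ENNReal.ofReal (K / (nuBall n * ρ ^ n)) * ∫⁻ y in E, v y with hB
  have hBtop : B ≠ ⊤ := ENNReal.mul_ne_top ENNReal.ofReal_ne_top hfin.ne
  have hbound : ∀ x ∈ closedBall x₀ ρ, v x ≤ B := by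
    intro x hx
    refine (hmean x hx ρ hρ le_rfl).trans ?_
    rw [hB]
    gcongr
    refine subset_trans (fun y hy => ?_) hE
    have := dist_triangle y x x₀
    rw [mem_ball] at hy
    rw [mem_closedBall] at hx ⊢
    linarith
  obtain ⟨k, hk⟩ := (Tendsto.eventually_const_lt hBtop.lt_top
    (ENNReal.tendsto_pow_atTop_nhds_top_iff.2 hq)).exists
  obtain ⟨x, hxd, hxv⟩ := hchain k
  have hxρ : x ∈ closedBall x₀ ρ := by
    rw [mem_closedBall, ← ENNReal.ofReal_le_ofReal_iff hρ.le, ← edist_dist]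
    exact hxd.trans (hsum k).le
  exact absurd (hbound x hxρ) (not_le.2
    (hk.trans_le ((pow_right_mono₀ hq.le (Nat.le_add_left k (J + N))).trans hxv.le)))

lemma mul_le_add_pow {n : ℕ} (hn : 1 ≤ n) (a b : ℝ≥0∞) : a * b ^ (n - 1) ≤ (a + b) ^ n := by
  obtain ⟨m, rfl⟩ := Nat.exists_eq_add_of_le' hn
  rw [Nat.add_sub_cancel, pow_succ']
  gcongr <;> simp

/-- Uniform Domar bound for all functions obeying the generalized mean value inequality whose
layers are controlled by a fixed function `G`. -/
lemma exists_nat_forall_le_pow {n : ℕ} (hn : 2 ≤ n) {K ρ : ℝ} (hρ : 0 < ρ)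
    {E : Set (EuclideanSpace ℝ (Fin n))} (hE : MeasurableSet E)
    {G : EuclideanSpace ℝ (Fin n) → ℝ≥0∞} (hGint : ∫⁻ y in E, G y < ⊤)
    {q : ℝ≥0∞} (hq : 1 < q) (hqt : q ≠ ⊤) {ψ : ℕ → ℝ≥0∞} (hψ : Monotone ψ)
    (hψt : ∀ j, ψ j ≠ ⊤) {J₀ : ℕ} (hsum : ∑' k : ℕ, (ψ (k + J₀) ^ (1 / ((n : ℝ) - 1)))⁻¹ < ⊤) :
    ∃ m : ℕ, ∀ v : EuclideanSpace ℝ (Fin n) → ℝ≥0∞, Measurable v →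
      (∀ y ∈ E, ∀ j : ℕ, q ^ j < v y → ψ j ≤ G y) → ∫⁻ y in E, v y < ⊤ →
      (∀ x r, 0 < r → closedBall x r ⊆ E →
        v x ≤ ENNReal.ofReal (K / (nuBall n * r ^ n)) * ∫⁻ y in ball x r, v y) →
      ∀ x, closedBall x (2 * ρ) ⊆ E → v x ≤ q ^ m := by
  set e : ℝ := 1 / ((n : ℝ) - 1) with he
  have hn2 : (2 : ℝ) ≤ n := by exact_mod_cast hn
  have he0 : 0 < e := by rw [he]; apply one_div_pos.2; linarith
  obtain ⟨N, hN⟩ := (Tendsto.eventually_const_lt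
    (show 2 * ENNReal.ofReal K < ⊤ by finiteness)
    (ENNReal.tendsto_pow_atTop_nhds_top_iff.2 hq)).exists
  set C := 2 * ENNReal.ofReal K * q / ENNReal.ofReal (nuBall n) with hC
  have hCt : C ≠ ⊤ := by
    have : ENNReal.ofReal (nuBall n) ≠ 0 := by simp [nuBall_pos]
    rw [hC]; finiteness
  set I := ∫⁻ y in E, G y with hI
  have hρ2 : ENNReal.ofReal ρ / 2 ≠ 0 := by simp [hρ]
  obtain ⟨l, hl0, hl⟩ := ENNReal.exists_nnreal_pos_mul_lt
    (show C * ((N + 1 : ℕ) * I) ≠ ⊤ by finiteness) hρ2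
  have hl0' : (l : ℝ≥0∞) ≠ 0 := by exact_mod_cast hl0.ne'
  set b : ℕ → ℝ≥0∞ := fun j => ((l * ψ j) ^ e)⁻¹ with hb
  have hbsum : ∑' k, b (k + J₀) ≠ ⊤ := by
    have : ∀ k, b (k + J₀) = ((l : ℝ≥0∞) ^ e)⁻¹ * (ψ (k + J₀) ^ e)⁻¹ := by
      intro k
      simp only [hb]
      rw [ENNReal.mul_rpow_of_nonneg _ _ he0.le, ENNReal.mul_inv]
      · exact Or.inl (by simp [ENNReal.rpow_eq_zero_iff, hl0.ne'])
      · exact Or.inl (by simp [ENNReal.rpow_eq_top_iff, hl0.ne'])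
    simp_rw [this, ENNReal.tsum_mul_left]
    refine ENNReal.mul_ne_top ?_ hsum.ne
    simp [ENNReal.rpow_eq_zero_iff, hl0.ne']
  obtain ⟨J, hJ⟩ := ((ENNReal.tendsto_sum_nat_add _ hbsum).eventually_lt_const
    (pos_iff_ne_zero.2 hρ2)).exists
  refine ⟨J + J₀ + N, fun v hv hG hfin hmean x hx => ?_⟩
  set μ : ℕ → ℝ≥0∞ := fun j =>
    volume (E ∩ {y | q ^ j < v y ∧ v y ≤ q ^ (j + (N + 1))}) with hμ
  have hlayer : ∑' j, ψ j * μ j ≤ (N + 1 : ℕ) * I :=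
    tsum_mul_volume_layer_le hv hE hq.le hψ hG (N + 1)
  have hmean' : ∀ y ∈ closedBall x ρ, ∀ r, 0 < r → r ≤ ρ →
      v y ≤ ENNReal.ofReal (K / (nuBall n * r ^ n)) * ∫⁻ z in ball y r, v z := by
    refine fun y hy r hr hrρ => hmean y r hr (subset_trans ?_ hx)
    exact closedBall_subset_closedBall' (by rw [mem_closedBall] at hy; linarith)
  have hRsum : ∑' k, (l * C * (ψ (k + (J + J₀)) * μ (k + (J + J₀))) + b (k + (J + J₀))) <
      ENNReal.ofReal ρ := by
    rw [ENNReal.tsum_add, ← ENNReal.add_halves (ENNReal.ofReal ρ)]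
    refine ENNReal.add_lt_add ?_ (by simpa only [add_assoc] using hJ)
    rw [ENNReal.tsum_mul_left]
    refine lt_of_le_of_lt ?_ hl
    rw [mul_assoc]
    gcongr
    exact (ENNReal.tsum_comp_le_tsum_of_injective (add_left_injective (J + J₀))
      (fun j => ψ j * μ j)).trans hlayer
  refine le_pow_of_tsum_radius_lt (R := fun j => l * C * (ψ j * μ j) + b j) hv hmean' hx hρ hfin hq
    hN.le (fun j => ?_) hRsum fun j => ?_
  · have : b j ≠ 0 := by
      refine ENNReal.inv_ne_zero.2 (ENNReal.rpow_ne_top_of_nonneg he0.le ?_)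
      exact ENNReal.mul_ne_top ENNReal.coe_ne_top (hψt j)
    simp [this]
  · have hpow : b j ^ (n - 1) = (l * ψ j)⁻¹ := by
      simp only [hb]
      rw [← ENNReal.inv_pow, ← ENNReal.rpow_natCast, ← ENNReal.rpow_mul,
        Nat.cast_sub (by omega), he]
      rw [Nat.cast_one, one_div_mul_cancel (by linarith), ENNReal.rpow_one]
    by_cases h0 : ψ j = 0
    · simp [hb, h0, he0, show n ≠ 0 by omega]
    refine le_trans ?_ (mul_le_add_pow (by omega) _ _)
    rw [hpow]
    calc C * μ j = C * μ j * ((l * ψ j) * (l * ψ j)⁻¹) := by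
          rw [ENNReal.mul_inv_cancel (mul_ne_zero hl0' h0)
            (ENNReal.mul_ne_top ENNReal.coe_ne_top (hψt j)), mul_one]
      _ ≤ _ := le_of_eq (by ring)

lemma coe_ennreal_eq_coe_toReal {t : ℝ≥0∞} (ht : t ≠ ⊤) :
    (t : EReal) = ((t.toReal : ℝ) : EReal) := by
  lift t to NNReal using ht
  rfl

lemma erealPos_eq_toENNReal (x : EReal) : erealPos x = x.toENNReal := rfl

lemma erealPos_sup_neg_zero_add_zero (x : EReal) :
    erealPos ((x ⊔ ((-0 : ℝ) : EReal)) + ((0 : ℝ) : EReal)) = x.toENNReal := by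
  rw [neg_zero, EReal.coe_zero, add_zero, erealPos_eq_toENNReal]
  rcases le_total x 0 with h | h
  · rw [sup_eq_right.2 h, EReal.toENNReal_of_nonpos h, EReal.toENNReal_zero]
  · rw [sup_eq_left.2 h]

lemma erealPos_sup_neg_add {x : EReal} (hx : 0 ≤ x) {M : ℝ} (hM : 0 ≤ M) :
    erealPos ((x ⊔ ((-M : ℝ) : EReal)) + ((M : ℝ) : EReal)) =
      x.toENNReal + ENNReal.ofReal M := by
  have hneg : ((-M : ℝ) : EReal) ≤ 0 := by exact_mod_cast neg_nonpos.2 hM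
  rw [sup_eq_left.2 (hneg.trans hx), erealPos_eq_toENNReal,
    EReal.toENNReal_add hx (by exact_mod_cast hM), EReal.real_coe_toENNReal]

lemma QNSubharmonicOn.toENNReal_le {n : ℕ} {K : ℝ} {u : EuclideanSpace ℝ (Fin n) → EReal}
    {D : Set (EuclideanSpace ℝ (Fin n))} (hu : QNSubharmonicOn K u D)
    {x : EuclideanSpace ℝ (Fin n)} {r : ℝ} (hr : 0 < r) (hxr : closedBall x r ⊆ D) :
    (u x).toENNReal ≤
      ENNReal.ofReal (K / (nuBall n * r ^ n)) * ∫⁻ y in ball x r, (u y).toENNReal := by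
  have h := hu.2.2.2 0 le_rfl x r hr hxr
  simpa only [erealPos_sup_neg_zero_add_zero] using h

/-- Adding a nonnegative constant preserves the generalized mean value inequality as `1 ≤ K`. -/
lemma QNSubharmonicOn.toENNReal_add_le {n : ℕ} {K : ℝ} (hK : 1 ≤ K)
    {u : EuclideanSpace ℝ (Fin n) → EReal}
    {D : Set (EuclideanSpace ℝ (Fin n))} (hu : QNSubharmonicOn K u D)
    {x : EuclideanSpace ℝ (Fin n)} {r : ℝ} (hr : 0 < r) (hxr : closedBall x r ⊆ D) (c : ℝ≥0∞) :
    (u x).toENNReal + c ≤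
      ENNReal.ofReal (K / (nuBall n * r ^ n)) * ∫⁻ y in ball x r, ((u y).toENNReal + c) := by
  rw [lintegral_add_right _ measurable_const, setLIntegral_const, mul_add, mul_left_comm,
    ofReal_div_nuBall_mul_volume hr]
  refine add_le_add (hu.toENNReal_le hr hxr) ?_
  calc c = c * 1 := (mul_one c).symm
    _ ≤ c * ENNReal.ofReal K := by gcongr; exact ENNReal.one_le_ofReal.2 hK

lemma measurable_indicator_toENNReal {α : Type*} [MeasurableSpace α] {D : Set α}
    (hD : MeasurableSet D) {u : α → EReal} (hu : Measurable (D.domRestrict u)) :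
    Measurable (D.indicator fun x => (u x).toENNReal) := by
  refine measurable_of_restrict_of_restrict_compl hD ?_ ?_
  · convert hu.ereal_toENNReal using 1
    ext z
    simp
  · convert measurable_const (a := (0 : ℝ≥0∞)) using 1
    ext z
    exact Set.indicator_of_notMem z.2 _

/-- A family of quasinearly subharmonic functions with a majorant satisfying the integral
condition is locally uniformly bounded. -/
lemma locally_bounded_of_integral_condition {n : ℕ} (hn : 2 ≤ n)
    {D : Set (EuclideanSpace ℝ (Fin n))} (hD : IsOpen D) {K : ℝ}
    {φ : ℝ≥0∞ → ℝ≥0∞} (hφ : StrictMono φ) {s₀ s₁ : ℕ} (hs : s₀ < s₁)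
    (hiv : ∫⁻ s in Set.Ioi ((s₁ : ℝ)),
      (φ (ENNReal.ofReal (s - (s₀ : ℝ))) ^ (1 / ((n : ℝ) - 1)))⁻¹ < ⊤)
    {F : EuclideanSpace ℝ (Fin n) → ℝ≥0∞} {𝓕 : Set (EuclideanSpace ℝ (Fin n) → EReal)}
    (h𝓕 : ∀ u ∈ 𝓕, QNSubharmonicOn K u D ∧ ∀ x ∈ D, u x ≤ ((F x : ℝ≥0∞) : EReal))
    {p : ℝ} (hp : 0 < p)
    (hint : ∀ E ⊆ D, IsCompact E → ∫⁻ x in E, φ (logPlusE ((F x) ^ p)) < ⊤)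
    {x : EuclideanSpace ℝ (Fin n)} (hx : x ∈ D) :
    ∃ r > (0 : ℝ), ∃ C : ℝ, ∀ y ∈ closedBall x r, ∀ u ∈ 𝓕, u y ≤ (C : EReal) := by
  obtain ⟨s, hs0, hsD⟩ := nhds_basis_closedBall.mem_iff.1 (hD.mem_nhds hx)
  set ρ := s / 3 with hρ
  have hρ0 : 0 < ρ := by positivity
  have hn2 : (2 : ℝ) ≤ n := by exact_mod_cast hn
  set q : ℝ≥0∞ := ENNReal.ofReal (Real.exp (1 / p)) with hq
  have hq1 : 1 < q := by
    rw [hq, ENNReal.one_lt_ofReal]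
    exact Real.one_lt_exp_iff.2 (by positivity)
  have hqt : q ≠ ⊤ := ENNReal.ofReal_ne_top
  have hcomp : IsCompact (closedBall x s) := isCompact_closedBall x s
  obtain ⟨m, hm⟩ := exists_nat_forall_le_pow hn (K := K) hρ0 (E := closedBall x s)
    measurableSet_closedBall (hint _ hsD hcomp) hq1 hqt (ψ := fun j : ℕ => φ j)
    (fun i j hij => hφ.monotone (by exact_mod_cast hij))
    (fun j => ((hφ (ENNReal.natCast_lt_top j)).trans_le le_top).ne)
    (J₀ := s₁ - s₀ + 1)
    (tsum_inv_rpow_lt_top hφ.monotone (one_div_nonneg.2 (by linarith)) hs hiv)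
  refine ⟨ρ, hρ0, (q ^ m).toReal, fun y hy u hu => ?_⟩
  obtain ⟨hqn, hle⟩ := h𝓕 u hu
  have hind : ∀ z ∈ closedBall x s,
      D.indicator (fun x => (u x).toENNReal) z = (u z).toENNReal :=
    fun z hz => Set.indicator_of_mem (hsD hz) _
  have hball : closedBall y (2 * ρ) ⊆ closedBall x s :=
    closedBall_subset_closedBall' (by rw [mem_closedBall] at hy; rw [hρ] at hy ⊢; linarith)
  have hys : y ∈ closedBall x s := hball (mem_closedBall_self (by positivity))
  have key := hm (D.indicator fun x => (u x).toENNReal)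
    (measurable_indicator_toENNReal hD.measurableSet hqn.1)
    (fun z hz j hj => by
      rw [hind z hz] at hj
      refine hφ.monotone (natCast_le_logPlusE_rpow hp (hj.trans_le ?_))
      simpa using EReal.toENNReal_le_toENNReal (hle z (hsD hz)))
    (by
      rw [setLIntegral_congr_fun measurableSet_closedBall hind]
      exact hqn.2.2.1 _ hsD hcomp)
    (fun z r hr hzr => by
      rw [hind z (hzr (mem_closedBall_self hr.le)), setLIntegral_congr_fun measurableSet_ball
        fun w hw => hind w (hzr (ball_subset_closedBall hw))]
      exact hqn.toENNReal_le hr (hzr.trans hsD))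
    y hball
  rw [hind y hys] at key
  calc u y ≤ ((u y).toENNReal : EReal) := by rw [EReal.coe_toENNReal_eq_max]; exact le_max_right _ _
    _ ≤ ((q ^ m : ℝ≥0∞) : EReal) := by exact_mod_cast key
    _ = (((q ^ m).toReal : ℝ) : EReal) :=
      coe_ennreal_eq_coe_toReal (ENNReal.pow_ne_top hqt)

/-- The upper semicontinuous regularization of a function on an open set is Borel there. -/
lemma measurable_domRestrict_limsup {X : Type*} [TopologicalSpace X] [MeasurableSpace X]
    [OpensMeasurableSpace X] {D : Set X} (hD : IsOpen D) (w : X → EReal) :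
    Measurable (D.domRestrict fun x => limsup w (nhdsWithin x D)) := by
  refine measurable_of_Iio fun a => ?_
  refine IsOpen.measurableSet ?_
  rw [isOpen_iff_mem_nhds]
  rintro ⟨x, hx⟩ hxa
  change limsup w (nhdsWithin x D) < a at hxa
  obtain ⟨c, hc, hca⟩ := exists_between hxa
  have hev := eventually_lt_of_limsup_lt hc
  rw [hD.nhdsWithin_eq hx] at hev
  have : ∀ᶠ z in nhds x, limsup w (nhdsWithin z D) < a :=
    hev.eventually_nhds.mono fun z hz => lt_of_le_of_lt
      (limsup_le_of_le (h := hz.filter_mono nhdsWithin_le_nhds |>.mono fun _ h => le_of_lt h)) hca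
  exact (continuous_subtype_val.tendsto (⟨x, hx⟩ : D)).eventually this

lemma le_limsup_nhdsWithin {X : Type*} [TopologicalSpace X] {D : Set X} {x : X} (hx : x ∈ D)
    (w : X → EReal) : w x ≤ limsup w (nhdsWithin x D) :=
  le_limsup_of_frequently_le' (frequently_iff.2 fun hU =>
    ⟨x, mem_of_mem_nhdsWithin hx hU, le_rfl⟩)

/-- The regularized supremum of the positive parts of a locally uniformly bounded family of
quasinearly subharmonic functions is quasinearly subharmonic. -/
lemma qnSubharmonicOn_limsup_iSup {n : ℕ} {D : Set (EuclideanSpace ℝ (Fin n))} (hD : IsOpen D)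
    {K : ℝ} (hK : 1 ≤ K) {𝓕 : Set (EuclideanSpace ℝ (Fin n) → EReal)} (h𝓕ne : 𝓕.Nonempty)
    (h𝓕 : ∀ u ∈ 𝓕, QNSubharmonicOn K u D)
    (hbdd : ∀ x ∈ D, ∃ r > (0 : ℝ), ∃ C : ℝ, ∀ y ∈ closedBall x r, ∀ u ∈ 𝓕, u y ≤ (C : EReal)) :
    QNSubharmonicOn K (fun x => limsup (fun y => ⨆ u ∈ 𝓕, (u y ⊔ 0)) (nhdsWithin x D)) D := by
  set W : EuclideanSpace ℝ (Fin n) → EReal := fun y => ⨆ u ∈ 𝓕, (u y ⊔ 0) with hW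
  set w : EuclideanSpace ℝ (Fin n) → EReal := fun x => limsup W (nhdsWithin x D) with hw
  have huW : ∀ u ∈ 𝓕, ∀ y, u y ⊔ 0 ≤ W y := fun u hu y =>
    le_iSup₂ (f := fun (u : EuclideanSpace ℝ (Fin n) → EReal) (_ : u ∈ 𝓕) => u y ⊔ 0) u hu
  have huw : ∀ u ∈ 𝓕, ∀ y ∈ D, u y ⊔ 0 ≤ w y := fun u hu y hy =>
    (huW u hu y).trans (le_limsup_nhdsWithin hy W)
  obtain ⟨u₀, hu₀⟩ := h𝓕ne
  have hw0 : ∀ y ∈ D, 0 ≤ w y := fun y hy => le_sup_right.trans (huw u₀ hu₀ y hy)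
  have hloc : ∀ x ∈ D, ∃ r > (0 : ℝ), ∃ C : ℝ, ∀ y ∈ ball x r, w y ≤ (C : EReal) := by
    intro x hx
    obtain ⟨r, hr, C, hC⟩ := hbdd x hx
    refine ⟨r, hr, max C 0, fun y hy => limsup_le_of_le (h := ?_)⟩
    filter_upwards [nhdsWithin_le_nhds (isOpen_ball.mem_nhds hy)] with z hz
    refine iSup₂_le fun u hu => sup_le ((hC z (ball_subset_closedBall hz) u hu).trans ?_) ?_
    · exact_mod_cast le_max_left C 0
    · exact_mod_cast le_max_right C 0
  refine ⟨measurable_domRestrict_limsup hD W, fun x hx => ?_, fun E hED hE => ?_,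
    fun M hM x r hr hxr => ?_⟩
  · obtain ⟨r, hr, C, hC⟩ := hloc x hx
    exact (hC x (mem_ball_self hr)).trans_lt (EReal.coe_lt_top C)
  · refine hE.induction_on (p := fun s => ∫⁻ y in s, erealPos (w y) < ⊤) (by simp)
      (fun s t hst ht => (lintegral_mono_set hst).trans_lt ht)
      (fun s t hs ht => (lintegral_union_le _ _ _).trans_lt (ENNReal.add_lt_top.2 ⟨hs, ht⟩))
      fun x hx => ?_
    obtain ⟨r, hr, C, hC⟩ := hloc x (hED hx)
    refine ⟨ball x r, mem_nhdsWithin_of_mem_nhds (ball_mem_nhds x hr), ?_⟩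
    calc ∫⁻ y in ball x r, erealPos (w y) ≤ ∫⁻ _ in ball x r, ENNReal.ofReal C :=
          setLIntegral_mono' measurableSet_ball fun y hy =>
            EReal.toENNReal_le_toENNReal (hC y hy)
      _ = ENNReal.ofReal C * volume (ball x r) := setLIntegral_const _ _
      _ < ⊤ := ENNReal.mul_lt_top ENNReal.ofReal_lt_top measure_ball_lt_top
  · have hxD : x ∈ D := hxr (mem_closedBall_self hr.le)
    rw [erealPos_sup_neg_add (hw0 x hxD) hM, setLIntegral_congr_fun measurableSet_ball
      fun y hy => erealPos_sup_neg_add (hw0 y (hxr (ball_subset_closedBall hy))) hM]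
    set I := ∫⁻ y in ball x r, ((w y).toENNReal + ENNReal.ofReal M) with hI
    have hsmaller : ∀ r', 0 < r' → r' < r →
        (w x).toENNReal + ENNReal.ofReal M ≤ ENNReal.ofReal (K / (nuBall n * r' ^ n)) * I := by
      intro r' hr' hr'r
      set T := ENNReal.ofReal (K / (nuBall n * r' ^ n)) * I with hT
      have hu : ∀ y ∈ ball x (r - r'), ∀ u ∈ 𝓕, (u y).toENNReal + ENNReal.ofReal M ≤ T := by
        intro y hy u hu
        rw [mem_ball] at hy
        have hsub : closedBall y r' ⊆ closedBall x r := closedBall_subset_closedBall' (by linarith)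
        have hsub' : ball y r' ⊆ ball x r := ball_subset_ball' (by linarith)
        refine ((h𝓕 u hu).toENNReal_add_le hK hr' (hsub.trans hxr) _).trans ?_
        rw [hT]
        gcongr
        refine (setLIntegral_mono' measurableSet_ball fun z hz => ?_).trans
          (lintegral_mono_set hsub')
        gcongr
        exact EReal.toENNReal_le_toENNReal (le_sup_left.trans
          (huw u hu z (hxr (hsub (ball_subset_closedBall hz)))))
      have hMT : ENNReal.ofReal M ≤ T :=
        le_add_self.trans (hu x (mem_ball_self (by linarith)) u₀ hu₀)
      have hwT : w x ≤ ((T - ENNReal.ofReal M : ℝ≥0∞) : EReal) := by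
        refine limsup_le_of_le (h := ?_)
        filter_upwards [nhdsWithin_le_nhds (ball_mem_nhds x (sub_pos.2 hr'r))] with y hy
        refine iSup₂_le fun u hu' => ?_
        rw [sup_comm, ← EReal.coe_toENNReal_eq_max]
        exact_mod_cast ENNReal.le_sub_of_add_le_right ENNReal.ofReal_ne_top (hu y hy u hu')
      calc (w x).toENNReal + ENNReal.ofReal M ≤ T - ENNReal.ofReal M + ENNReal.ofReal M := by
            gcongr
            simpa using EReal.toENNReal_le_toENNReal hwT
        _ = T := tsub_add_cancel_of_le hMT
    have hν := nuBall_pos n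
    have hlim : Tendsto (fun r' : ℝ => ENNReal.ofReal (K / (nuBall n * r' ^ n)) * I)
        (nhdsWithin r (Set.Iio r)) (nhds (ENNReal.ofReal (K / (nuBall n * r ^ n)) * I)) := by
      refine ENNReal.Tendsto.mul_const (ENNReal.tendsto_ofReal ?_) (Or.inl ?_)
      · refine ContinuousAt.tendsto ?_ |>.mono_left nhdsWithin_le_nhds
        exact continuousAt_const.div (by fun_prop) (by positivity)
      · have : 0 < K / (nuBall n * r ^ n) := by positivity
        simpa using this
    refine ge_of_tendsto hlim ?_
    filter_upwards [Ioo_mem_nhdsLT hr] with r' hr'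
    exact hsmaller r' hr'.1 hr'.2

theorem corollary_log_condition
    (n : ℕ) (hn : 2 ≤ n)
    (D : Set (EuclideanSpace ℝ (Fin n))) (hDopen : IsOpen D) (hDconn : IsConnected D)
    (K : ℝ) (hK : 1 ≤ K)
    (φ : ℝ≥0∞ → ℝ≥0∞) (hφ : StrictMono φ)
    (s₀ s₁ : ℕ) (hs : s₀ < s₁)
    (hiv : ∫⁻ s in Set.Ioi ((s₁ : ℝ)),
      (φ (ENNReal.ofReal (s - (s₀ : ℝ))) ^ (1 / ((n : ℝ) - 1)))⁻¹ < ⊤)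
    (F : EuclideanSpace ℝ (Fin n) → ℝ≥0∞) (hFmeas : Measurable (D.restrict F))
    (𝓕 : Set (EuclideanSpace ℝ (Fin n) → EReal)) (h𝓕ne : 𝓕.Nonempty)
    (h𝓕 : ∀ u ∈ 𝓕, QNSubharmonicOn K u D ∧ ∀ x ∈ D, u x ≤ ((F x : ℝ≥0∞) : EReal))
    (p : ℝ) (hp : 0 < p)
    (hint : ∀ E ⊆ D, IsCompact E → ∫⁻ x in E, φ (logPlusE ((F x) ^ p)) < ⊤) :
    (∀ x ∈ D, ∃ r > (0 : ℝ), ∃ C : ℝ, ∀ y ∈ closedBall x r ∩ D, ∀ u ∈ 𝓕, u y ≤ (C : EReal)) ∧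
    (∀ x ∈ D, 0 ≤ Filter.limsup (fun y => ⨆ u ∈ 𝓕, (u y ⊔ 0)) (nhdsWithin x D)) ∧
    QNSubharmonicOn K (fun x => Filter.limsup (fun y => ⨆ u ∈ 𝓕, (u y ⊔ 0)) (nhdsWithin x D)) D := by
  have hbdd := fun x (hx : x ∈ D) =>
    locally_bounded_of_integral_condition hn hDopen hφ hs hiv h𝓕 hp hint hx
  refine ⟨fun x hx => ?_, fun x hx => ?_,
    qnSubharmonicOn_limsup_iSup hDopen hK h𝓕ne (fun u hu => (h𝓕 u hu).1) hbdd⟩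
  · obtain ⟨r, hr, C, hC⟩ := hbdd x hx
    exact ⟨r, hr, C, fun y hy => hC y hy.1⟩
  · obtain ⟨u₀, hu₀⟩ := h𝓕ne
    refine le_trans ?_ (le_limsup_nhdsWithin hx _)
    exact le_trans le_sup_right (le_iSup₂
      (f := fun (u : EuclideanSpace ℝ (Fin n) → EReal) (_ : u ∈ 𝓕) => u x ⊔ 0) u₀ hu₀)
end
end

section
/- Let K ≥ 1 and let φ, ψ, s₀, s₁ satisfy conditions (i)–(iv). Let F_K : D → [0,+∞] be Lebesgue measurable and let 𝓕_K be a family of K-quasinearly subharmonic functions u : D → [-∞,+∞) such that u(x) ≤ F_K(x) for all x ∈ D, and suppose that for each compact set E ⊂ D one has ∫_E ψ(F_K(x)) dm_n(x) < +∞. If the function w(x) := sup_{u ∈ 𝓕_K} u⁺(x) is Lebesgue measurable, then w itself is K-quasinearly subharmonic in D. -/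
open MeasureTheory Metric Filter Set ENNReal

noncomputable section

lemma tsum_le_setLIntegral_of_antitoneOn {f : ℝ → ℝ≥0∞} {a : ℝ} (hf : AntitoneOn f (Ioi a)) :
    ∑' i : ℕ, f (a + i + 1) ≤ ∫⁻ s in Ioi a, f s := by
  have hdisj : Pairwise (Function.onFun Disjoint fun i : ℕ => Ioc (a + i) (a + i + 1)) := by
    intro i j hij
    have := pairwise_disjoint_Ioc_add_intCast a (i := (i : ℤ)) (j := (j : ℤ))
      (by exact_mod_cast hij)
    simpa [Function.onFun] using this
  calc ∑' i : ℕ, f (a + i + 1)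
      = ∑' i : ℕ, ∫⁻ _ in Ioc (a + (i : ℝ)) (a + i + 1), f (a + i + 1) := by
        simp
    _ ≤ ∑' i : ℕ, ∫⁻ s in Ioc (a + (i : ℝ)) (a + i + 1), f s := by
        refine ENNReal.tsum_le_tsum fun i => setLIntegral_mono' measurableSet_Ioc fun s hs => ?_
        have hi : (0 : ℝ) ≤ i := i.cast_nonneg
        exact hf (by simp only [mem_Ioi]; linarith [hs.1]) (by simp only [mem_Ioi]; linarith) hs.2
    _ = ∫⁻ s in ⋃ i : ℕ, Ioc (a + (i : ℝ)) (a + i + 1), f s :=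
        (lintegral_iUnion (fun _ => measurableSet_Ioc) hdisj f).symm
    _ ≤ ∫⁻ s in Ioi a, f s := by
        refine lintegral_mono_set (iUnion_subset fun i s hs => ?_)
        have hi : (0 : ℝ) ≤ i := i.cast_nonneg
        simp only [mem_Ioi]; linarith [hs.1]

/-- Conditions (i)-(iv) yield levels `G i` along which `ψ` grows fast enough for the iteration. -/
lemma exists_levels {n : ℕ} (hn : 2 ≤ n) {K : ℝ} {φ ψ φinv ψinv : ℝ≥0∞ → ℝ≥0∞}
    (hφ : Monotone φ) (hψ : Monotone ψ) {s₀ s₁ : ℕ} (hs : s₀ < s₁)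
    (hφinv : ∀ t : ℝ≥0∞, min (φ ((s₁ - s₀ : ℕ) : ℝ≥0∞)) (ψ ((s₁ - s₀ : ℕ) : ℝ≥0∞)) ≤ t →
      φ (φinv t) = t ∧ ∀ s, φ s = t → s = φinv t)
    (hψinv : ∀ t : ℝ≥0∞, min (φ ((s₁ - s₀ : ℕ) : ℝ≥0∞)) (ψ ((s₁ - s₀ : ℕ) : ℝ≥0∞)) ≤ t →
      ψ (ψinv t) = t ∧ ∀ s, ψ s = t → s = ψinv t)
    (hii : ∀ s : ℝ, (s₁ : ℝ) ≤ s →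
      ENNReal.ofReal (2 * K) * ψinv (φ (ENNReal.ofReal (s - (s₀ : ℝ)))) ≤
        ψinv (φ (ENNReal.ofReal s)))
    (hiii : ∃ C : ℝ≥0∞, C ≠ ⊤ ∧ ∀ s : ℝ, (s₁ : ℝ) + 1 ≤ s →
      ψinv (φ (ENNReal.ofReal (s + 1))) ≤ C * ψinv (φ (ENNReal.ofReal s)))
    (hiv : ∫⁻ s in Set.Ioi ((s₁ : ℝ)),
      (φ (ENNReal.ofReal (s - (s₀ : ℝ))) ^ (1 / ((n : ℝ) - 1)))⁻¹ < ⊤) :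
    ∃ (G : ℕ → ℝ≥0∞) (C : ℝ≥0∞), C ≠ ⊤ ∧ Monotone G ∧ (∀ i, G i ≠ 0) ∧ (∀ i, G i ≠ ⊤) ∧
      (∀ i, ENNReal.ofReal (2 * K) * G i ≤ G (i + s₀)) ∧
      (∀ i, G (i + s₀ + 1) ≤ C * G (i + s₀)) ∧
      (∀ i, ψ (G i) ≠ 0) ∧ (∀ i, ψ (G i) ≠ ⊤) ∧
      ∑' i, (ψ (G i) ^ (1 / ((n : ℝ) - 1)))⁻¹ ≠ ⊤ := by
  obtain ⟨d, rfl⟩ := Nat.exists_eq_add_of_le hs.le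
  obtain ⟨C, hC, hiii⟩ := hiii
  simp only [Nat.add_sub_cancel_left] at hφinv hψinv
  have hexp : 0 ≤ 1 / ((n : ℝ) - 1) := by
    have : (2 : ℝ) ≤ n := by exact_mod_cast hn
    exact one_div_nonneg.2 (by linarith)
  set m := min (φ d) (ψ d)
  have hm : ∀ j : ℕ, d ≤ j → m ≤ φ j := fun j hj =>
    (min_le_left _ _).trans (hφ (by exact_mod_cast hj))
  have hψG : ∀ j : ℕ, d ≤ j → ψ (ψinv (φ j)) = φ j := fun j hj => (hψinv _ (hm j hj)).1
  have hφinj : ∀ (j : ℕ) (t : ℝ≥0∞), d ≤ j → φ t = φ j → t = j := fun j t hj h =>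
    ((hφinv _ (hm j hj)).2 t h).trans ((hφinv _ (hm j hj)).2 j rfl).symm
  have hφtop : ∀ j : ℕ, d ≤ j → φ j ≠ ⊤ := fun j hj h => by
    have h1 : φ ⊤ = φ j := by
      rw [h]
      exact top_le_iff.1 (((hφinv ⊤ le_top).1).symm.le.trans (hφ le_top))
    exact ENNReal.natCast_ne_top j (hφinj j ⊤ hj h1).symm
  have hψtop : ψ ⊤ = ⊤ := top_le_iff.1 (((hψinv ⊤ le_top).1).symm.le.trans (hψ le_top))
  have hφlt : ∀ j : ℕ, d ≤ j → φ j < φ (j + 1 : ℕ) := fun j hj =>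
    lt_of_le_of_ne (hφ (by exact_mod_cast j.le_succ)) fun h => by
      have := hφinj j _ hj h.symm
      exact absurd (Nat.cast_injective this) (Nat.succ_ne_self j)
  have hcast : ∀ j : ℕ, ENNReal.ofReal (j : ℝ) = j := fun j => ENNReal.ofReal_natCast j
  have hGmono : ∀ j k : ℕ, d ≤ j → j ≤ k → ψinv (φ j) ≤ ψinv (φ k) := fun j k hj hjk => by
    by_contra! h
    have h1 : φ k ≤ φ j := by
      rw [← hψG j hj, ← hψG k (hj.trans hjk)]
      exact hψ h.le
    have h2 : φ j ≤ φ k := hφ (by exact_mod_cast hjk)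
    rw [le_antisymm h1 h2] at h
    exact lt_irrefl _ h
  refine ⟨fun i => ψinv (φ (d + 1 + i : ℕ)), C, hC, ?_, ?_, ?_, ?_, ?_, ?_, ?_, ?_⟩
  · exact fun i k hik => hGmono _ _ (by omega) (by omega)
  · intro i h
    beta_reduce at h
    have h0 : ψinv (φ (d + i : ℕ)) = 0 := by
      have := hGmono (d + i) (d + 1 + i) (by omega) (by omega)
      exact nonpos_iff_eq_zero.1 (this.trans h.le)
    have h1 := hψG (d + 1 + i) (by omega)
    have h2 := hψG (d + i) (by omega)
    have h3 := hφlt (d + i) (by omega)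
    rw [show d + i + 1 = d + 1 + i by ring, ← h1, ← h2, h0] at h3
    rw [h] at h3
    exact lt_irrefl _ h3
  · intro i h
    beta_reduce at h
    have h1 := hψG (d + 1 + i) (by omega)
    rw [h, hψtop] at h1
    exact hφtop _ (by omega) h1.symm
  · intro i
    have := hii ((d + 1 + (i + s₀) : ℕ) : ℝ)
      (by push_cast; linarith [(i.cast_nonneg : (0 : ℝ) ≤ i)])
    rw [show ((d + 1 + (i + s₀) : ℕ) : ℝ) - s₀ = ((d + 1 + i : ℕ) : ℝ) by push_cast; ring,
      hcast, hcast] at this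
    exact this
  · intro i
    have := hiii ((d + 1 + (i + s₀) : ℕ) : ℝ)
      (by push_cast; linarith [(i.cast_nonneg : (0 : ℝ) ≤ i)])
    rw [show ((d + 1 + (i + s₀) : ℕ) : ℝ) + 1 = ((d + 1 + (i + s₀ + 1) : ℕ) : ℝ) by
      push_cast; ring, hcast, hcast] at this
    exact this
  · intro i
    rw [hψG _ (by omega)]
    have := hφlt (d + i) (by omega)
    rw [show d + 1 + i = d + i + 1 by ring]
    exact ne_bot_of_gt this
  · intro i
    rw [hψG _ (by omega)]
    exact hφtop _ (by omega)
  · refine ne_top_of_le_ne_top hiv.ne (le_trans (le_of_eq ?_)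
      (tsum_le_setLIntegral_of_antitoneOn fun s _ t _ hst => ?_))
    · refine tsum_congr fun i => ?_
      rw [hψG _ (by omega), show ((s₀ + d : ℕ) : ℝ) + i + 1 - s₀ = ((d + 1 + i : ℕ) : ℝ) by
        push_cast; ring, hcast]
    · exact ENNReal.inv_le_inv.2 (ENNReal.rpow_le_rpow
        (hφ (ENNReal.ofReal_le_ofReal (by linarith))) hexp)

lemma exists_lt_of_two_mul_le {G : ℕ → ℝ≥0∞} (h0 : G 0 ≠ 0) {s : ℕ}
    (h2 : ∀ i, 2 * G i ≤ G (i + s)) {B : ℝ≥0∞} (hB : B ≠ ⊤) : ∃ N, B < G N := by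
  have hpow : ∀ k : ℕ, 2 ^ k * G 0 ≤ G (k * s) := by
    intro k
    induction k with
    | zero => simp
    | succ k ih =>
      calc 2 ^ (k + 1) * G 0 = 2 * (2 ^ k * G 0) := by ring
        _ ≤ 2 * G (k * s) := by gcongr
        _ ≤ G ((k + 1) * s) := by rw [add_one_mul]; exact h2 _
  obtain ⟨k, hk⟩ := ENNReal.exists_nat_mul_gt h0 hB
  refine ⟨k * s, hk.trans_le (le_trans ?_ (hpow k))⟩
  gcongr
  exact_mod_cast k.lt_two_pow_self.le

/-- Sets cut out by overlapping windows of levels meet each point at most `s + 1` times. -/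
lemma tsum_indicator_levels_le {α : Type*} {G : ℕ → ℝ≥0∞} (hG : Monotone G) (s : ℕ)
    {ψ : ℝ≥0∞ → ℝ≥0∞} (hψ : Monotone ψ) (v : α → ℝ≥0∞) (x : α) :
    ∑' i, {y | G i ≤ v y ∧ v y < G (i + s + 1)}.indicator (fun _ => ψ (G i)) x ≤
      (s + 1) * ψ (v x) := by
  classical
  by_cases hex : ∃ i, G i ≤ v x ∧ v x < G (i + s + 1)
  · obtain ⟨hN, -⟩ := id (Nat.find_spec hex)
    set N := Nat.find hex
    have hsupp : ∀ i ∉ Finset.Icc N (N + s),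
        {y | G i ≤ v y ∧ v y < G (i + s + 1)}.indicator (fun _ => ψ (G i)) x = 0 := by
      intro i hi
      refine indicator_of_notMem (fun hx => hi ?_) _
      refine Finset.mem_Icc.2 ⟨Nat.find_min' hex hx, ?_⟩
      by_contra! h
      exact absurd ((hG (show N + s + 1 ≤ i by omega)).trans hx.1)
        (not_le.2 (Nat.find_spec hex).2)
    rw [tsum_eq_sum hsupp]
    refine (Finset.sum_le_card_nsmul _ _ (ψ (v x)) fun i _ => ?_).trans (le_of_eq ?_)
    · by_cases hx : x ∈ {y | G i ≤ v y ∧ v y < G (i + s + 1)}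
      · rw [indicator_of_mem hx]
        exact hψ hx.1
      · rw [indicator_of_notMem hx]
        exact zero_le
    · rw [Nat.card_Icc, nsmul_eq_mul, show N + s + 1 - N = s + 1 by omega]
      push_cast
      rfl
  · push Not at hex
    have : ∀ i, {y | G i ≤ v y ∧ v y < G (i + s + 1)}.indicator (fun _ => ψ (G i)) x = 0 :=
      fun i => indicator_of_notMem (fun hx => absurd hx.2 (not_lt.2 (hex i hx.1))) _
    simp [this]

lemma volume_ball_eq_ofReal {n : ℕ} (x : EuclideanSpace ℝ (Fin n)) {r : ℝ} (hr : 0 < r) :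
    volume (ball x r) = ENNReal.ofReal (nuBall n * r ^ n) := by
  rw [Measure.addHaar_ball_of_pos _ _ hr, finrank_euclideanSpace_fin, mul_comm (nuBall n),
    ENNReal.ofReal_mul (by positivity), nuBall, ENNReal.ofReal_toReal measure_ball_lt_top.ne]

lemma ofReal_div_nuBall_mul {n : ℕ} {K : ℝ} (x : EuclideanSpace ℝ (Fin n)) {r : ℝ} (hr : 0 < r) :
    ENNReal.ofReal (K / (nuBall n * r ^ n)) * volume (ball x r) = ENNReal.ofReal K := by
  have hν := nuBall_pos n
  rw [volume_ball_eq_ofReal x hr, ← ENNReal.ofReal_mul' (by positivity),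
    div_mul_cancel₀ _ (by positivity)]

/-- If the mean of `v` over `B` is large, `v` takes intermediate values on a large set. -/
lemma measure_le_of_mul_le_setLIntegral {α : Type*} [MeasurableSpace α] {μ : Measure α}
    {A B : Set α} (hB : MeasurableSet B) (hBtop : μ B ≠ ⊤) {K a L C : ℝ≥0∞}
    (hL0 : L ≠ 0) (hL : L ≠ ⊤) (ha : 2 * K * a ≤ L) {v : α → ℝ≥0∞}
    (hv : μ B * L ≤ K * ∫⁻ y in B, v y ∂μ) (hlow : ∀ y ∈ B, y ∉ A → v y ≤ a)
    (hup : ∀ y ∈ B, v y ≤ C * L) : μ B ≤ 2 * K * C * μ A := by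
  have h1 : ∫⁻ y in B, v y ∂μ ≤ a * μ B + C * L * μ A := by
    calc ∫⁻ y in B, v y ∂μ
        ≤ ∫⁻ y in B, (a + A.indicator (fun _ => C * L) y) ∂μ := by
          refine setLIntegral_mono' hB fun y hy => ?_
          by_cases hyA : y ∈ A
          · rw [indicator_of_mem hyA]
            exact (hup y hy).trans le_add_self
          · exact (hlow y hy hyA).trans le_self_add
      _ = a * μ B + ∫⁻ y in B, A.indicator (fun _ => C * L) y ∂μ := by
          rw [lintegral_add_left measurable_const, setLIntegral_const]
      _ ≤ a * μ B + C * L * μ A := by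
          gcongr
          exact (lintegral_indicator_const_le _ _).trans
            (mul_le_mul_right (Measure.restrict_apply_le _ _) _)
  have h2 : μ B * L + μ B * L ≤ μ B * L + 2 * K * C * μ A * L := by
    calc μ B * L + μ B * L = 2 * (μ B * L) := by ring
      _ ≤ 2 * (K * (a * μ B + C * L * μ A)) :=
        mul_le_mul_right (hv.trans (mul_le_mul_right h1 _)) _
      _ = (2 * K * a) * μ B + 2 * K * C * μ A * L := by ring
      _ ≤ L * μ B + 2 * K * C * μ A * L := by gcongr
      _ = μ B * L + 2 * K * C * μ A * L := by ring
  exact (ENNReal.mul_le_mul_iff_left hL0 hL).1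
    ((ENNReal.add_le_add_iff_left (ENNReal.mul_ne_top hBtop hL)).1 h2)

/-- A bounded function cannot climb through the levels `L i` along a chain of steps with
summable lengths. -/
lemma lt_level_of_climbing {X : Type*} [PseudoMetricSpace X] {v : X → ℝ≥0∞} {L : ℕ → ℝ≥0∞}
    {R : ℕ → ℝ} (hR : ∀ i, 0 ≤ R i) {x₀ : X} {ρ : ℝ}
    (hstep : ∀ i y, dist y x₀ + R i ≤ ρ → L i ≤ v y → ∃ z ∈ ball y (R i), L (i + 1) ≤ v z)
    (k i : ℕ) (hbdd : ∀ z, dist z x₀ ≤ ρ → v z < L (i + k)) (y : X)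
    (hy : dist y x₀ + ∑ j ∈ Finset.range k, R (i + j) ≤ ρ) : v y < L i := by
  induction k generalizing i y with
  | zero => exact hbdd y (by simpa using hy)
  | succ k ih =>
    rw [Finset.sum_range_succ'] at hy
    have hsum : 0 ≤ ∑ j ∈ Finset.range k, R (i + (j + 1)) := Finset.sum_nonneg fun _ _ => hR _
    by_contra! h
    obtain ⟨z, hz, hLz⟩ := hstep i y (by simp only [add_zero] at hy; linarith) h
    refine absurd hLz (not_le.2 (ih (i + 1)
      (by simpa only [add_right_comm, add_assoc] using hbdd) z ?_))
    have h1 := dist_triangle z y x₀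
    rw [mem_ball] at hz
    simp only [add_zero] at hy
    simp only [add_assoc, add_comm 1]
    linarith

lemma mul_pow_lt_add_pow_succ {x y : ℝ} (hx : 0 ≤ x) (hy : 0 < y) (m : ℕ) :
    x * y ^ m < (x + y) ^ (m + 1) := by
  calc x * y ^ m < (x + y) * y ^ m := by gcongr; linarith
    _ ≤ (x + y) * (x + y) ^ m := by gcongr; linarith
    _ = (x + y) ^ (m + 1) := by ring

lemma toReal_mul_inv_rpow_pow {p : ℝ≥0∞} (h0 : p ≠ 0) (htop : p ≠ ⊤) (m : ℕ) :
    p.toReal * ((p ^ (1 / (((m + 2 : ℕ) : ℝ) - 1)))⁻¹).toReal ^ (m + 1) = 1 := by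
  have hp : 0 < p.toReal := ENNReal.toReal_pos h0 htop
  rw [ENNReal.toReal_inv, ← ENNReal.toReal_rpow, inv_pow, ← Real.rpow_natCast (_ ^ _),
    ← Real.rpow_mul hp.le]
  have : 1 / (((m + 2 : ℕ) : ℝ) - 1) * ((m + 1 : ℕ) : ℝ) = 1 := by
    have : (m : ℝ) + 1 ≠ 0 := by positivity
    push_cast
    rw [show (m : ℝ) + 2 - 1 = m + 1 by ring]
    field_simp
  rw [this, Real.rpow_one, mul_inv_cancel₀ hp.ne']

lemma tsum_mul_measure_levels_le {α : Type*} [MeasurableSpace α] {μ : Measure α}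
    {G : ℕ → ℝ≥0∞} (hG : Monotone G) (s : ℕ) {ψ : ℝ≥0∞ → ℝ≥0∞} (hψ : Monotone ψ)
    {v : α → ℝ≥0∞} (hv : Measurable v) :
    ∑' i, ψ (G i) * μ {y | G i ≤ v y ∧ v y < G (i + s + 1)} ≤
      (s + 1) * ∫⁻ x, ψ (v x) ∂μ := by
  have hmeas : ∀ i, MeasurableSet {y | G i ≤ v y ∧ v y < G (i + s + 1)} := fun i =>
    (measurableSet_le measurable_const hv).inter (measurableSet_lt hv measurable_const)
  calc ∑' i, ψ (G i) * μ {y | G i ≤ v y ∧ v y < G (i + s + 1)}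
      = ∑' i, ∫⁻ x, {y | G i ≤ v y ∧ v y < G (i + s + 1)}.indicator (fun _ => ψ (G i)) x ∂μ := by
        simp_rw [lintegral_indicator_const (hmeas _)]
    _ = ∫⁻ x, ∑' i, {y | G i ≤ v y ∧ v y < G (i + s + 1)}.indicator (fun _ => ψ (G i)) x ∂μ :=
        (lintegral_tsum fun i => (measurable_const.indicator (hmeas i)).aemeasurable).symm
    _ ≤ ∫⁻ x, (s + 1) * ψ (v x) ∂μ := lintegral_mono fun x => tsum_indicator_levels_le hG s hψ v x
    _ = (s + 1) * ∫⁻ x, ψ (v x) ∂μ := lintegral_const_mul' _ _ (by finiteness)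

lemma sum_range_toReal_le {f : ℕ → ℝ≥0∞} {B : ℝ} (hB : 0 ≤ B)
    (h : ∑' i, f i ≤ ENNReal.ofReal B) (k : ℕ) :
    ∑ j ∈ Finset.range k, (f j).toReal ≤ B := by
  have hfin : ∀ j, f j ≠ ⊤ := fun j =>
    ne_top_of_le_ne_top ENNReal.ofReal_ne_top ((ENNReal.le_tsum j).trans h)
  rw [← ENNReal.toReal_sum fun j _ => hfin j]
  exact ENNReal.toReal_le_of_le_ofReal hB ((ENNReal.sum_le_tsum _).trans h)

/-- Functions dominated by `F` with the generalized mean value property are locally bounded,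
uniformly in the function. -/
lemma exists_forall_le_of_levels {n : ℕ} (hn : 2 ≤ n) {D : Set (EuclideanSpace ℝ (Fin n))}
    (hD : IsOpen D) {K : ℝ} (hK : 1 ≤ K) {ψ : ℝ≥0∞ → ℝ≥0∞} (hψ : Monotone ψ) {s : ℕ}
    {G : ℕ → ℝ≥0∞} {C : ℝ≥0∞} (hC : C ≠ ⊤) (hG : Monotone G) (hG0 : ∀ i, G i ≠ 0)
    (hGtop : ∀ i, G i ≠ ⊤) (hG2 : ∀ i, ENNReal.ofReal (2 * K) * G i ≤ G (i + s))
    (hGC : ∀ i, G (i + s + 1) ≤ C * G (i + s)) (hψ0 : ∀ i, ψ (G i) ≠ 0)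
    (hψtop : ∀ i, ψ (G i) ≠ ⊤) (hsum : ∑' i, (ψ (G i) ^ (1 / ((n : ℝ) - 1)))⁻¹ ≠ ⊤)
    {F : EuclideanSpace ℝ (Fin n) → ℝ≥0∞}
    (hint : ∀ E ⊆ D, IsCompact E → ∫⁻ x in E, ψ (F x) < ⊤)
    {x₀ : EuclideanSpace ℝ (Fin n)} (hx₀ : x₀ ∈ D) :
    ∃ δ > 0, ∃ B : ℝ≥0∞, B ≠ ⊤ ∧ ∀ v : EuclideanSpace ℝ (Fin n) → ℝ≥0∞, Measurable v →
      (∀ x ∈ D, v x ≤ F x) → (∀ E ⊆ D, IsCompact E → ∫⁻ x in E, v x < ⊤) →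
      (∀ x r, 0 < r → closedBall x r ⊆ D →
        v x ≤ ENNReal.ofReal (K / (nuBall n * r ^ n)) * ∫⁻ y in ball x r, v y) →
      ∀ y ∈ ball x₀ δ, v y ≤ B := by
  obtain ⟨m, rfl⟩ := Nat.exists_eq_add_of_le' hn
  obtain ⟨ε, hε, hεD⟩ := Metric.nhds_basis_closedBall.mem_iff.1 (hD.mem_nhds hx₀)
  obtain ⟨δ, hδ, rfl⟩ : ∃ δ > 0, 3 * δ = ε := ⟨ε / 3, by positivity, by ring⟩
  have hν := nuBall_pos (m + 2)
  set E := closedBall x₀ (3 * δ)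
  have hEc : IsCompact E := isCompact_closedBall _ _
  set I := (s + 1) * ∫⁻ x in E, ψ (F x)
  have hItop : I ≠ ⊤ := ENNReal.mul_ne_top (by finiteness) (hint E hεD hEc).ne
  obtain ⟨l, hl, hlI⟩ : ∃ l : ℝ, 0 < l ∧ l * I.toReal ≤ δ / 2 := by
    have : 0 < I.toReal + 1 := by positivity
    refine ⟨δ / 2 / (I.toReal + 1), by positivity, ?_⟩
    rw [div_mul_eq_mul_div, div_le_iff₀ this]
    gcongr
    linarith
  obtain ⟨μ, hμ, hμl⟩ : ∃ μ : ℝ, 0 < μ ∧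
      2 * K * C.toReal ≤ nuBall (m + 2) * l * μ ^ (m + 1) := by
    have hq : 0 ≤ 2 * K * C.toReal / (nuBall (m + 2) * l) := by positivity
    refine ⟨1 + 2 * K * C.toReal / (nuBall (m + 2) * l), by positivity, ?_⟩
    have h1 := le_self_pow₀ (M₀ := ℝ) (a := 1 + 2 * K * C.toReal / (nuBall (m + 2) * l))
      (by linarith) (n := m + 1) (by omega)
    rw [← div_le_iff₀' (by positivity)]
    linarith
  set b : ℕ → ℝ≥0∞ := fun i => (ψ (G i) ^ (1 / (((m + 2 : ℕ) : ℝ) - 1)))⁻¹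
  have hbpos : ∀ i, 0 < (b i).toReal := fun i => by
    refine (ENNReal.toReal_nonneg).lt_of_ne' fun h => ?_
    have := toReal_mul_inv_rpow_pow (hψ0 i) (hψtop i) m
    change _ * (b i).toReal ^ _ = _ at this
    simp [h] at this
  obtain ⟨i₀, hi₀⟩ : ∃ i₀, ∑' k, b (i₀ + k) ≤ ENNReal.ofReal (δ / (2 * μ)) := by
    have h0 : (0 : ℝ≥0∞) < ENNReal.ofReal (δ / (2 * μ)) := ENNReal.ofReal_pos.2 (by positivity)
    obtain ⟨i₀, h⟩ := ((ENNReal.tendsto_sum_nat_add b hsum).eventually_lt_const h0).exists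
    exact ⟨i₀, by simpa only [add_comm] using h.le⟩
  refine ⟨δ, hδ, G (i₀ + s), hGtop _, fun v hvm hvF hvint hv y hy => ?_⟩
  set A : ℕ → Set (EuclideanSpace ℝ (Fin (m + 2))) :=
    fun i => {y | G i ≤ v y ∧ v y < G (i + s + 1)}
  set a : ℕ → ℝ≥0∞ := fun i => volume.restrict E (A i)
  have hatop : ∀ i, a i ≠ ⊤ := fun i =>
    ne_top_of_le_ne_top hEc.measure_lt_top.ne
      ((measure_mono (subset_univ _)).trans_eq (Measure.restrict_apply_univ E))
  have hasum : ∑' i, ψ (G i) * a i ≤ I := by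
    refine (tsum_mul_measure_levels_le hG s hψ hvm).trans ?_
    exact mul_le_mul_right (setLIntegral_mono' measurableSet_closedBall
      fun x hx => hψ (hvF x (hεD hx))) _
  set R : ℕ → ℝ := fun i => l * (ψ (G i) * a i).toReal + μ * (b i).toReal with hR
  have hR0 : ∀ i, 0 < R i := fun i => by
    have := hbpos i
    positivity
  obtain ⟨B, hBtop, hB⟩ : ∃ B : ℝ≥0∞, B ≠ ⊤ ∧ ∀ z, dist z x₀ ≤ 2 * δ → v z ≤ B := by
    refine ⟨ENNReal.ofReal (K / (nuBall (m + 2) * δ ^ (m + 2))) * ∫⁻ x in E, v x,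
      ENNReal.mul_ne_top ENNReal.ofReal_ne_top (hvint E hεD hEc).ne, fun z hz => ?_⟩
    have hsub : closedBall z δ ⊆ E := closedBall_subset_closedBall' (by linarith)
    refine (hv z δ hδ (hsub.trans hεD)).trans ?_
    gcongr
    exact ball_subset_closedBall.trans hsub
  obtain ⟨k, hk⟩ : ∃ k, B < G k := by
    refine exists_lt_of_two_mul_le (hG0 0) (fun i => le_trans ?_ (hG2 i)) hBtop
    gcongr
    rw [← ENNReal.ofReal_ofNat 2]
    exact ENNReal.ofReal_le_ofReal (by linarith)
  have hsumR : ∑ j ∈ Finset.range k, R (i₀ + j) ≤ δ := by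
    have h1 : ∑ j ∈ Finset.range k, (ψ (G (i₀ + j)) * a (i₀ + j)).toReal ≤ I.toReal := by
      refine sum_range_toReal_le ENNReal.toReal_nonneg ?_ k
      rw [ENNReal.ofReal_toReal hItop]
      exact (ENNReal.tsum_comp_le_tsum_of_injective (add_right_injective i₀) _).trans hasum
    have h2 := sum_range_toReal_le (by positivity) hi₀ k
    calc ∑ j ∈ Finset.range k, R (i₀ + j)
        = l * ∑ j ∈ Finset.range k, (ψ (G (i₀ + j)) * a (i₀ + j)).toReal +
          μ * ∑ j ∈ Finset.range k, (b (i₀ + j)).toReal := by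
          rw [Finset.mul_sum, Finset.mul_sum, Finset.sum_add_distrib]
      _ ≤ l * I.toReal + μ * (δ / (2 * μ)) := by gcongr
      _ ≤ δ / 2 + δ / 2 := by
          gcongr
          exact le_of_eq (by field_simp)
      _ = δ := by ring
  refine (lt_level_of_climbing (L := fun i => G (i + s)) (fun i => (hR0 i).le) (ρ := 2 * δ)
    ?_ k i₀ (fun z hz => ((hB z hz).trans_lt hk).trans_le (hG (by omega))) y ?_).le
  · intro i x hx hGx
    by_contra! hlt
    have hsub : closedBall x (R i) ⊆ E := closedBall_subset_closedBall' (by linarith)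
    have hlt' : ∀ z ∈ ball x (R i), v z < G (i + s + 1) := fun z hz => by
      simpa only [add_right_comm] using hlt z hz
    have hvx := hv x (R i) (hR0 i) (hsub.trans hεD)
    have hvol : volume (ball x (R i)) ≤ 2 * ENNReal.ofReal K * C * volume (A i ∩ E) := by
      refine measure_le_of_mul_le_setLIntegral (v := v) (a := G i) measurableSet_ball
        measure_ball_lt_top.ne (hG0 (i + s)) (hGtop _) ?_ ?_ ?_ ?_
      · simpa [ENNReal.ofReal_mul] using hG2 i
      · calc volume (ball x (R i)) * G (i + s)
            ≤ volume (ball x (R i)) * (ENNReal.ofReal (K / (nuBall (m + 2) * R i ^ (m + 2))) *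
              ∫⁻ y in ball x (R i), v y) := by gcongr; exact hGx.trans hvx
          _ = ENNReal.ofReal K * ∫⁻ y in ball x (R i), v y := by
              rw [← mul_assoc, mul_comm (volume _), ofReal_div_nuBall_mul x (hR0 i)]
      · intro z hz hzA
        by_contra! h
        exact hzA ⟨⟨h.le, hlt' z hz⟩, hsub (ball_subset_closedBall hz)⟩
      · exact fun z hz => (hlt' z hz).le.trans (hGC i)
    rw [← Measure.restrict_apply' measurableSet_closedBall, volume_ball_eq_ofReal x (hR0 i)] at hvol
    have hreal : nuBall (m + 2) * R i ^ (m + 2) ≤ 2 * K * C.toReal * (a i).toReal := by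
      have := ENNReal.toReal_mono (by have := hatop i; finiteness) hvol
      rwa [ENNReal.toReal_ofReal (by have := hR0 i; positivity), ENNReal.toReal_mul,
        ENNReal.toReal_mul, ENNReal.toReal_mul, ENNReal.toReal_ofReal (by linarith),
        ENNReal.toReal_ofNat] at this
    have hpow := mul_pow_lt_add_pow_succ (x := l * (ψ (G i) * a i).toReal)
      (y := μ * (b i).toReal) (by positivity) (by have := hbpos i; positivity) (m + 1)
    have hpb := toReal_mul_inv_rpow_pow (hψ0 i) (hψtop i) m
    change _ * (b i).toReal ^ _ = _ at hpb
    have heq : l * (ψ (G i) * a i).toReal * (μ * (b i).toReal) ^ (m + 1) =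
        l * μ ^ (m + 1) * (a i).toReal := by
      rw [ENNReal.toReal_mul, mul_pow]
      linear_combination l * (a i).toReal * μ ^ (m + 1) * hpb
    rw [heq] at hpow
    have h3 := mul_lt_mul_of_pos_left hpow hν
    have h4 := mul_le_mul_of_nonneg_right hμl (ENNReal.toReal_nonneg (a := a i))
    have h5 : nuBall (m + 2) * R i ^ (m + 2) ≤ nuBall (m + 2) * l * μ ^ (m + 1) * (a i).toReal :=
      hreal.trans h4
    simp only [hR] at h5
    linarith
  · rw [mem_ball] at hy
    linarith

lemma EReal.toENNReal_sup_zero (x : EReal) : (x ⊔ 0).toENNReal = x.toENNReal := by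
  rw [sup_comm, ← EReal.coe_toENNReal_eq_max, EReal.toENNReal_coe]

theorem remark_w_measurable
    (n : ℕ) (hn : 2 ≤ n)
    (D : Set (EuclideanSpace ℝ (Fin n))) (hDopen : IsOpen D) (hDconn : IsConnected D)
    (K : ℝ) (hK : 1 ≤ K)
    (φ ψ φinv ψinv : ℝ≥0∞ → ℝ≥0∞) (hφ : Monotone φ) (hψ : Monotone ψ)
    (s₀ s₁ : ℕ) (hs : s₀ < s₁)
    (hφinv : ∀ t : ℝ≥0∞, min (φ ((s₁ - s₀ : ℕ) : ℝ≥0∞)) (ψ ((s₁ - s₀ : ℕ) : ℝ≥0∞)) ≤ t →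
      φ (φinv t) = t ∧ ∀ s, φ s = t → s = φinv t)
    (hψinv : ∀ t : ℝ≥0∞, min (φ ((s₁ - s₀ : ℕ) : ℝ≥0∞)) (ψ ((s₁ - s₀ : ℕ) : ℝ≥0∞)) ≤ t →
      ψ (ψinv t) = t ∧ ∀ s, ψ s = t → s = ψinv t)
    (hii : ∀ s : ℝ, (s₁ : ℝ) ≤ s →
      ENNReal.ofReal (2 * K) * ψinv (φ (ENNReal.ofReal (s - (s₀ : ℝ)))) ≤
        ψinv (φ (ENNReal.ofReal s)))
    (hiii : ∃ C : ℝ≥0∞, C ≠ ⊤ ∧ ∀ s : ℝ, (s₁ : ℝ) + 1 ≤ s →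
      ψinv (φ (ENNReal.ofReal (s + 1))) ≤ C * ψinv (φ (ENNReal.ofReal s)))
    (hiv : ∫⁻ s in Set.Ioi ((s₁ : ℝ)),
      (φ (ENNReal.ofReal (s - (s₀ : ℝ))) ^ (1 / ((n : ℝ) - 1)))⁻¹ < ⊤)
    (F : EuclideanSpace ℝ (Fin n) → ℝ≥0∞) (hFmeas : Measurable (D.restrict F))
    (𝓕 : Set (EuclideanSpace ℝ (Fin n) → EReal)) (h𝓕ne : 𝓕.Nonempty)
    (h𝓕 : ∀ u ∈ 𝓕, QNSubharmonicOn K u D ∧ ∀ x ∈ D, u x ≤ ((F x : ℝ≥0∞) : EReal))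
    (hint : ∀ E ⊆ D, IsCompact E → ∫⁻ x in E, ψ (F x) < ⊤)
    (hwmeas : Measurable (D.restrict (fun x => ⨆ u ∈ 𝓕, (u x ⊔ 0)))) :
    QNSubharmonicOn K (fun x => ⨆ u ∈ 𝓕, (u x ⊔ 0)) D := by
  obtain ⟨G, C, hC, hG, hG0, hGtop, hG2, hGC, hψ0, hψtop, hsum⟩ :=
    exists_levels hn hφ hψ hs hφinv hψinv hii hiii hiv
  set w : EuclideanSpace ℝ (Fin n) → EReal := fun x => ⨆ u ∈ 𝓕, (u x ⊔ 0) with hw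
  have herealPos : ∀ x, erealPos x = x.toENNReal := fun _ => rfl
  have hw0 : ∀ x, 0 ≤ w x := fun x => by
    obtain ⟨u, hu⟩ := h𝓕ne
    exact le_sup_right.trans (le_iSup₂ (f := fun u (_ : u ∈ 𝓕) => u x ⊔ 0) u hu)
  have hle_w : ∀ u ∈ 𝓕, ∀ x, (u x).toENNReal ≤ (w x).toENNReal := fun u hu x =>
    EReal.toENNReal_le_toENNReal
      (le_sup_left.trans (le_iSup₂ (f := fun u (_ : u ∈ 𝓕) => u x ⊔ 0) u hu))
  have hw_le : ∀ x (B : ℝ≥0∞), (∀ u ∈ 𝓕, (u x).toENNReal ≤ B) → (w x).toENNReal ≤ B :=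
    fun x B h => by
      rw [← EReal.toENNReal_coe (x := B)]
      refine EReal.toENNReal_le_toENNReal (iSup₂_le fun u hu => ?_)
      rw [sup_comm, ← EReal.coe_toENNReal_eq_max]
      exact EReal.coe_ennreal_le_coe_ennreal_iff.2 (h u hu)
  have hmean : ∀ u ∈ 𝓕, ∀ x r, 0 < r → closedBall x r ⊆ D → (u x).toENNReal ≤
      ENNReal.ofReal (K / (nuBall n * r ^ n)) * ∫⁻ y in ball x r, (u y).toENNReal :=
    fun u hu x r hr hx => by
      simpa [herealPos, EReal.toENNReal_sup_zero] using (h𝓕 u hu).1.2.2.2 0 le_rfl x r hr hx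
  have hloc : ∀ x₀ ∈ D, ∃ δ > 0, ∃ B : ℝ≥0∞, B ≠ ⊤ ∧
      ∀ y ∈ ball x₀ δ, y ∈ D → (w y).toENNReal ≤ B := fun x₀ hx₀ => by
    obtain ⟨δ, hδ, B, hB, h⟩ := exists_forall_le_of_levels hn hDopen hK hψ hC hG hG0 hGtop hG2
      hGC hψ0 hψtop hsum hint hx₀
    refine ⟨δ, hδ, B, hB, fun y hy hyD => hw_le y B fun u hu => ?_⟩
    obtain ⟨⟨hum, -, huint, -⟩, huF⟩ := h𝓕 u hu
    have hind : ∀ x ∈ D, D.indicator (fun x => (u x).toENNReal) x = (u x).toENNReal :=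
      fun x hx => indicator_of_mem hx _
    have hindint : ∀ A ⊆ D, MeasurableSet A →
        ∫⁻ x in A, D.indicator (fun x => (u x).toENNReal) x = ∫⁻ x in A, (u x).toENNReal :=
      fun A hAD hA => setLIntegral_congr_fun hA fun x hx => hind x (hAD hx)
    rw [← hind y hyD]
    refine h _ ?_ (fun x hx => ?_) (fun E hE hEc => ?_) (fun x r hr hx => ?_) y hy
    · refine measurable_of_restrict_of_restrict_compl hDopen.measurableSet ?_ ?_
      · convert! hum.ereal_toENNReal using 1
        exact funext fun x => hind x x.2
      · convert! (measurable_const (a := (0 : ℝ≥0∞))) using 1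
        exact funext fun x => indicator_of_notMem x.2 _
    · rw [hind x hx, ← EReal.toENNReal_coe (x := F x)]
      exact EReal.toENNReal_le_toENNReal (huF x hx)
    · rw [hindint E hE hEc.measurableSet]
      exact huint E hE hEc
    · rw [hind x (hx (mem_closedBall_self hr.le)),
        hindint _ (ball_subset_closedBall.trans hx) measurableSet_ball]
      exact hmean u hu x r hr hx
  refine ⟨hwmeas, fun x hx => ?_, fun E hE hEc => ?_, fun M hM x r hr hx => ?_⟩
  · obtain ⟨δ, hδ, B, hB, h⟩ := hloc x hx
    rw [lt_top_iff_ne_top, ← EReal.toENNReal_ne_top_iff]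
    exact ne_top_of_le_ne_top hB (h x (mem_ball_self hδ) hx)
  · obtain ⟨B, hB, h⟩ : ∃ B : ℝ≥0∞, B ≠ ⊤ ∧ ∀ y ∈ E, (w y).toENNReal ≤ B := by
      refine hEc.induction_on (p := fun S => ∃ B : ℝ≥0∞, B ≠ ⊤ ∧ ∀ y ∈ S, (w y).toENNReal ≤ B)
        ⟨0, by simp⟩ (fun S T hST ⟨B, hB, h⟩ => ⟨B, hB, fun y hy => h y (hST hy)⟩)
        (fun S T ⟨B, hB, h⟩ ⟨B', hB', h'⟩ => ⟨max B B', by simp [hB, hB'], fun y hy =>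
          hy.elim (fun hy => (h y hy).trans (le_max_left _ _))
            fun hy => (h' y hy).trans (le_max_right _ _)⟩) fun x hx => ?_
      obtain ⟨δ, hδ, B, hB, h⟩ := hloc x (hE hx)
      exact ⟨ball x δ ∩ E, inter_mem (mem_nhdsWithin_of_mem_nhds (ball_mem_nhds x hδ))
        self_mem_nhdsWithin, B, hB, fun y hy => h y hy.1 (hE hy.2)⟩
    calc ∫⁻ x in E, erealPos (w x) ≤ ∫⁻ _ in E, B := setLIntegral_mono' hEc.measurableSet h
      _ = B * volume E := setLIntegral_const _ _
      _ < ⊤ := ENNReal.mul_lt_top hB.lt_top hEc.measure_lt_top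
  · have hshift : ∀ y, erealPos ((w y ⊔ ((-M : ℝ) : EReal)) + ((M : ℝ) : EReal)) =
        (w y).toENNReal + ENNReal.ofReal M := fun y => by
      have hM' : ((-M : ℝ) : EReal) ≤ 0 := by exact_mod_cast neg_nonpos.2 hM
      rw [sup_eq_left.2 (hM'.trans (hw0 y)), herealPos,
        EReal.toENNReal_add (hw0 y) (by exact_mod_cast hM), EReal.real_coe_toENNReal]
    change erealPos ((w x ⊔ _) + _) ≤ _ * ∫⁻ y in ball x r, erealPos ((w y ⊔ _) + _)
    simp_rw [hshift]
    rw [lintegral_add_right _ measurable_const, setLIntegral_const, mul_add]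
    refine add_le_add (hw_le x _ fun u hu => (hmean u hu x r hr hx).trans ?_) ?_
    · gcongr
      exact hle_w u hu _
    · calc ENNReal.ofReal M ≤ ENNReal.ofReal K * ENNReal.ofReal M :=
            le_mul_of_one_le_left zero_le (ENNReal.one_le_ofReal.2 hK)
        _ = _ := by rw [← ofReal_div_nuBall_mul x hr]; ring
end
end

section
/- Let K ≥ 1, let φ : [0,+∞] → [0,+∞] be a strictly increasing function, and let s₀ < s₁ be natural numbers such that ∫_{s₁}^{+∞} ds/(φ(s-s₀))^{1/(n-1)} < +∞. Let ϕ : [0,+∞] → [0,+∞] be any strictly increasing function such that (a) ϕ⁻¹ satisfies the Δ₂-condition, and (b) 2K·ϕ⁻¹(e^{s-s₀}) ≤ ϕ⁻¹(e^s) for all s ≥ s₁. Set ψ(t) := (φ∘log⁺)(ϕ(t)). Let F_K : D → [0,+∞] be Lebesgue measurable and let 𝓕_K be a family of K-quasinearly subharmonic functions u : D → [-∞,+∞) such that u(x) ≤ F_K(x) for all x ∈ D. If for each compact set E ⊂ D one has ∫_E ψ(F_K(x)) dm_n(x) < +∞, then the family 𝓕_K is locally uniformly bounded in D, and the function w*(x)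 := limsup_{y→x} w(y), where w(x) := sup_{u ∈ 𝓕_K} u⁺(x), is a K-quasinearly subharmonic function on D (with finite values). -/
open MeasureTheory Metric Filter Set ENNReal

noncomputable section

section LocalBoundedness

variable {n : ℕ}

/-- The mean value constant is `K` divided by the volume of the ball. -/
lemma ofReal_div_nuBall_eq {K r : ℝ} (hr : 0 < r) (x : EuclideanSpace ℝ (Fin n)) :
    ENNReal.ofReal (K / (nuBall n * r ^ n)) = ENNReal.ofReal K / volume (ball x r) := by
  have hν : 0 < nuBall n :=
    ENNReal.toReal_pos (measure_ball_pos _ _ one_pos).ne' measure_ball_lt_top.ne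
  rw [ENNReal.ofReal_div_of_pos (by positivity), Measure.addHaar_ball_of_pos _ _ hr, nuBall,
    ENNReal.ofReal_mul ENNReal.toReal_nonneg, ENNReal.ofReal_toReal measure_ball_lt_top.ne,
    finrank_euclideanSpace_fin, mul_comm]

/-- The sub-mean-value inequality with constant `K` on the closed balls contained in `D`, for a
nonnegative function. -/
def SubMeanValueOn (K : ℝ≥0∞) (v : EuclideanSpace ℝ (Fin n) → ℝ≥0∞)
    (D : Set (EuclideanSpace ℝ (Fin n))) : Prop :=
  ∀ x r, 0 < r → closedBall x r ⊆ D → v x ≤ K / volume (ball x r) * ∫⁻ y in ball x r, v y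

lemma SubMeanValueOn.mono {K : ℝ≥0∞} {v : EuclideanSpace ℝ (Fin n) → ℝ≥0∞}
    {D D' : Set (EuclideanSpace ℝ (Fin n))} (hv : SubMeanValueOn K v D) (h : D' ⊆ D) :
    SubMeanValueOn K v D' := fun x r hr hx => hv x r hr (hx.trans h)

/-- A large value of `v` at `x` forces an even larger value of `v` near `x`, provided the
intermediate level set is small. -/
lemma SubMeanValueOn.exists_ge_of_measure_lt {K C α β γ : ℝ≥0∞}
    {v : EuclideanSpace ℝ (Fin n) → ℝ≥0∞} {S : Set (EuclideanSpace ℝ (Fin n))}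
    (hv : SubMeanValueOn K v S)
    (hαβ : 2 * K * α ≤ β) (hγβ : γ ≤ C * β) (hβ : β ≠ 0) (hβ' : β ≠ ⊤)
    {x : EuclideanSpace ℝ (Fin n)} {R : ℝ} (hR : 0 < R) (hx : β ≤ v x)
    (hS : closedBall x R ⊆ S)
    (hm : 2 * K * C * volume.restrict S (v ⁻¹' Ico α γ) < volume (ball x R)) :
    ∃ y ∈ ball x R, γ ≤ v y := by
  by_contra! hlt
  set V := volume (ball x R)
  have hV0 : V ≠ 0 := (measure_ball_pos _ _ hR).ne'
  have hVt : V ≠ ⊤ := measure_ball_lt_top.ne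
  set m := volume.restrict S (v ⁻¹' Ico α γ)
  have hint : ∫⁻ y in ball x R, v y ≤ α * V + γ * m := by
    calc ∫⁻ y in ball x R, v y
        ≤ ∫⁻ y in ball x R, (α + (v ⁻¹' Ico α γ).indicator (fun _ => γ) y) := by
          refine setLIntegral_mono' measurableSet_ball fun y hy => ?_
          rcases lt_or_ge (v y) α with h | h
          · exact h.le.trans le_self_add
          · rw [indicator_of_mem (show y ∈ v ⁻¹' Ico α γ from ⟨h, hlt y hy⟩)]
            exact (hlt y hy).le.trans le_add_self
      _ = α * V + ∫⁻ y in ball x R, (v ⁻¹' Ico α γ).indicator (fun _ => γ) y := by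
          rw [lintegral_add_left measurable_const, setLIntegral_const]
      _ ≤ α * V + γ * volume.restrict (ball x R) (v ⁻¹' Ico α γ) := by
          gcongr
          exact lintegral_indicator_const_le _ _
      _ ≤ α * V + γ * m := by
          gcongr
          exact Measure.restrict_mono (ball_subset_closedBall.trans hS) le_rfl _
  have h1 : 2 * β ≤ β + β * (2 * K * C * m / V) := by
    calc 2 * β ≤ 2 * (K / V * (α * V + γ * m)) := by
          gcongr
          exact hx.trans ((hv x R hR hS).trans (by gcongr))
      _ = 2 * K * α * (V / V) + 2 * K * γ * m / V := by
          simp only [div_eq_mul_inv]; ring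
      _ ≤ β + 2 * K * (C * β) * m / V := by
          rw [ENNReal.div_self hV0 hVt, mul_one]; gcongr
      _ = β + β * (2 * K * C * m / V) := by
          simp only [div_eq_mul_inv]; ring
  have h2 : 2 * K * C * m / V < 1 := by
    rw [ENNReal.div_lt_iff (Or.inl hV0) (Or.inl hVt)]; simpa using hm
  have h3 : β * (2 * K * C * m / V) < β * 1 := by
    exact ENNReal.mul_lt_mul_right hβ hβ' h2
  rw [two_mul] at h1
  have := ENNReal.add_lt_add_left hβ' h3
  rw [mul_one] at this
  exact absurd h1 (not_le.mpr this)

/-- Hölder's inequality for the radii. -/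
lemma sum_rpow_inv_le (hn : 2 ≤ n) (s : Finset ℕ) {b m : ℕ → ℝ≥0∞}
    (hb : ∀ i, b i ≠ 0) (hb' : ∀ i, b i ≠ ⊤) :
    ∑ i ∈ s, m i ^ (1 / (n : ℝ)) ≤ (∑ i ∈ s, b i * m i) ^ (1 / (n : ℝ)) *
      (∑ i ∈ s, (b i ^ (1 / ((n : ℝ) - 1)))⁻¹) ^ (((n : ℝ) - 1) / n) := by
  have hn' : (2 : ℝ) ≤ n := by exact_mod_cast hn
  have hpq : (n : ℝ).HolderConjugate ((n : ℝ) / (n - 1)) :=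
    Real.HolderConjugate.conjExponent (by linarith)
  have h := ENNReal.inner_le_Lp_mul_Lq s (fun i => (b i * m i) ^ (1 / (n : ℝ)))
    (fun i => (b i ^ (1 / (n : ℝ)))⁻¹) hpq
  have e1 : ∀ i, (b i * m i) ^ (1 / (n : ℝ)) * (b i ^ (1 / (n : ℝ)))⁻¹ = m i ^ (1 / (n : ℝ)) := by
    intro i
    rw [ENNReal.mul_rpow_of_nonneg _ _ (by positivity), mul_comm (b i ^ _), mul_assoc,
      ENNReal.mul_inv_cancel, mul_one]
    · simp [ENNReal.rpow_eq_zero_iff, hb, hb']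
    · exact ENNReal.rpow_ne_top_of_nonneg (by positivity) (hb' i)
  have e2 : ∀ i, ((b i * m i) ^ (1 / (n : ℝ))) ^ (n : ℝ) = b i * m i := by
    intro i
    rw [← ENNReal.rpow_mul, one_div_mul_cancel (by positivity), ENNReal.rpow_one]
  have e3 : ∀ i, ((b i ^ (1 / (n : ℝ)))⁻¹) ^ ((n : ℝ) / (n - 1)) =
      (b i ^ (1 / ((n : ℝ) - 1)))⁻¹ := by
    intro i
    rw [ENNReal.inv_rpow, ← ENNReal.rpow_mul]
    congr 2
    field_simp
  simp only [e1, e2, e3] at h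
  rwa [one_div_div] at h

/-- The level sets `a i ≤ v < a (i + k)` overlap at most `k` times. -/
lemma sum_mul_measure_level_le {X : Type*} [MeasurableSpace X] {μ : Measure X}
    {v G : X → ℝ≥0∞} (hv : AEMeasurable v μ) {a b : ℕ → ℝ≥0∞} (ha : StrictMono a)
    (k : ℕ) (hG : ∀ᵐ y ∂μ, ∀ i, a i ≤ v y → b i ≤ G y) (s : Finset ℕ) :
    ∑ i ∈ s, b i * μ (v ⁻¹' Ico (a i) (a (i + k))) ≤ k * ∫⁻ y, G y ∂μ := by
  have hnm : ∀ i, NullMeasurableSet (v ⁻¹' Ico (a i) (a (i + k))) μ := fun i =>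
    hv.nullMeasurableSet_preimage measurableSet_Ico
  calc ∑ i ∈ s, b i * μ (v ⁻¹' Ico (a i) (a (i + k)))
      = ∑ i ∈ s, ∫⁻ y, (v ⁻¹' Ico (a i) (a (i + k))).indicator (fun _ => b i) y ∂μ := by
        refine Finset.sum_congr rfl fun i _ => ?_
        rw [lintegral_indicator_const₀ (hnm i)]
    _ = ∫⁻ y, ∑ i ∈ s, (v ⁻¹' Ico (a i) (a (i + k))).indicator (fun _ => b i) y ∂μ := by
        rw [lintegral_finsetSum']
        exact fun i _ => aemeasurable_const.indicator₀ (hnm i)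
    _ ≤ ∫⁻ y, k * G y ∂μ := by
        refine lintegral_mono_ae (hG.mono fun y hy => ?_)
        by_cases hex : ∃ i, v y ∈ Ico (a i) (a (i + k))
        · classical
          set j := Nat.find hex
          have hj : v y ∈ Ico (a j) (a (j + k)) := Nat.find_spec hex
          calc ∑ i ∈ s, (v ⁻¹' Ico (a i) (a (i + k))).indicator (fun _ => b i) y
              ≤ ∑ i ∈ s, if i ∈ Finset.Ico j (j + k) then G y else 0 := by
                refine Finset.sum_le_sum fun i _ => ?_
                by_cases hi : v y ∈ Ico (a i) (a (i + k))
                · have h1 : j ≤ i := Nat.find_min' hex hi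
                  have h2 : i < j + k := ha.lt_iff_lt.mp (hi.1.trans_lt hj.2)
                  rw [indicator_of_mem (show y ∈ v ⁻¹' Ico (a i) (a (i + k)) from hi),
                    if_pos (Finset.mem_Ico.mpr ⟨h1, h2⟩)]
                  exact hy i hi.1
                · rw [indicator_of_notMem (show y ∉ v ⁻¹' Ico (a i) (a (i + k)) from hi)]
                  exact zero_le
            _ = ∑ i ∈ s ∩ Finset.Ico j (j + k), G y := by
                rw [Finset.sum_ite_mem]
            _ ≤ ∑ i ∈ Finset.Ico j (j + k), G y :=
                Finset.sum_le_sum_of_subset Finset.inter_subset_right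
            _ = k * G y := by simp
        · push Not at hex
          rw [Finset.sum_eq_zero fun i _ =>
            indicator_of_notMem (show y ∉ v ⁻¹' Ico (a i) (a (i + k)) from hex i) _]
          exact zero_le
    _ = k * ∫⁻ y, G y ∂μ := lintegral_const_mul' _ _ (by simp)

/-- A Domar type theorem: the functions satisfying the sub-mean-value inequality and dominated
through `G` are uniformly bounded near `x₀`. -/
lemma exists_uniform_bound (hn : 2 ≤ n) {K C : ℝ≥0∞} (hK : K ≠ ⊤) (hC : C ≠ ⊤) {a b : ℕ → ℝ≥0∞}
    (ha : StrictMono a) (ha0 : a 0 ≠ 0) (ha_unb : ∀ B, B ≠ ⊤ → ∃ i, B < a i) {s₀ i₀ : ℕ}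
    (haK : ∀ i, i₀ ≤ i → 2 * K * a i ≤ a (i + s₀)) (haC : ∀ i, a (i + 1) ≤ C * a i)
    (hb : ∀ i, i₀ ≤ i → b i ≠ 0) (hb' : ∀ i, b i ≠ ⊤)
    (hsum : ∑' i, (b (i + i₀) ^ (1 / ((n : ℝ) - 1)))⁻¹ ≠ ⊤)
    {G : EuclideanSpace ℝ (Fin n) → ℝ≥0∞} {x₀ : EuclideanSpace ℝ (Fin n)} {ρ : ℝ} (hρ : 0 < ρ)
    (hG : ∫⁻ y in closedBall x₀ (2 * ρ), G y ≠ ⊤) :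
    ∃ J, ∀ v : EuclideanSpace ℝ (Fin n) → ℝ≥0∞, SubMeanValueOn K v (closedBall x₀ (3 * ρ)) →
      ∫⁻ y in closedBall x₀ (3 * ρ), v y ≠ ⊤ →
      AEMeasurable v (volume.restrict (closedBall x₀ (2 * ρ))) →
      (∀ y ∈ closedBall x₀ (2 * ρ), ∀ i, a i ≤ v y → b i ≤ G y) →
      ∀ x ∈ closedBall x₀ ρ, v x ≤ a J := by
  have hn' : (2 : ℝ) ≤ n := by exact_mod_cast hn
  set S := closedBall x₀ (2 * ρ)
  set V := volume (ball (0 : EuclideanSpace ℝ (Fin n)) 1)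
  have hV0 : V ≠ 0 := (measure_ball_pos _ _ one_pos).ne'
  have hVt : V ≠ ⊤ := measure_ball_lt_top.ne
  set B := 2 * K * C / V with hBdef
  have hB : B ≠ ⊤ := ENNReal.div_ne_top (by finiteness) hV0
  set Q := ((s₀ + 1 : ℕ) : ℝ≥0∞) * ∫⁻ y in S, G y
  have hQ : Q ≠ ⊤ := ENNReal.mul_ne_top (by simp) hG
  set tail : ℕ → ℝ≥0∞ := fun J => ∑' i, (b (i + J + i₀) ^ (1 / ((n : ℝ) - 1)))⁻¹
  have hlim : Tendsto (fun J => (B * Q) ^ (1 / (n : ℝ)) * tail J ^ (((n : ℝ) - 1) / n))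
      atTop (nhds 0) := by
    have h1 : Tendsto tail atTop (nhds 0) :=
      ENNReal.tendsto_sum_nat_add (fun i => (b (i + i₀) ^ (1 / ((n : ℝ) - 1)))⁻¹) hsum
    have h2 : 0 < ((n : ℝ) - 1) / n := div_pos (by linarith) (by linarith)
    have h3 := (ENNReal.continuous_rpow_const (y := ((n : ℝ) - 1) / n)).tendsto 0 |>.comp h1
    rw [ENNReal.zero_rpow_of_pos h2] at h3
    have h4 := ENNReal.Tendsto.const_mul (a := (B * Q) ^ (1 / (n : ℝ))) h3
      (Or.inr (ENNReal.rpow_ne_top_of_nonneg (by positivity) (ENNReal.mul_ne_top hB hQ)))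
    rwa [mul_zero] at h4
  obtain ⟨J, hJ⟩ := (ENNReal.tendsto_nhds_zero.mp hlim (ENNReal.ofReal (ρ / 2))
    (by simpa using hρ)).exists
  refine ⟨J + i₀ + s₀, fun v hv hvint hvm hvG x hx => ?_⟩
  by_contra! hlt
  set m : ℕ → ℝ≥0∞ := fun k => volume.restrict S
    (v ⁻¹' Ico (a (k + J + i₀)) (a (k + J + i₀ + (s₀ + 1))))
  have hS : volume S ≠ ⊤ := measure_closedBall_lt_top.ne
  have hm : ∀ k, m k ≠ ⊤ := fun k => by
    refine ne_top_of_le_ne_top hS ((measure_mono (subset_univ _)).trans ?_)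
    rw [Measure.restrict_apply_univ]
  set R : ℕ → ℝ := fun k => ((B * m k) ^ (1 / (n : ℝ))).toReal + ρ / 4 * (1 / 2) ^ k with hRdef
  have hRpos : ∀ k, 0 < R k := fun k => by positivity
  have hfin : ∀ k, (B * m k) ^ (1 / (n : ℝ)) ≠ ⊤ := fun k =>
    ENNReal.rpow_ne_top_of_nonneg (by positivity) (ENNReal.mul_ne_top hB (hm k))
  have hsumR : ∀ k, ∑ i ∈ Finset.range k, R i ≤ ρ := by
    intro k
    have h1 : ∑ i ∈ Finset.range k, (B * m i) ^ (1 / (n : ℝ)) ≤ ENNReal.ofReal (ρ / 2) := by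
      refine (sum_rpow_inv_le hn (Finset.range k) (b := fun i => b (i + J + i₀))
        (fun i => hb _ (by omega)) (fun i => hb' _)).trans (le_trans ?_ hJ)
      gcongr
      · calc ∑ i ∈ Finset.range k, b (i + J + i₀) * (B * m i)
            = B * ∑ i ∈ Finset.range k, b (i + J + i₀) * m i := by
              rw [Finset.mul_sum]; exact Finset.sum_congr rfl fun i _ => by ring
          _ ≤ B * Q := by
              gcongr
              have hmono : StrictMono fun i => a (i + J + i₀) := fun i j hij => ha (by omega)
              have := sum_mul_measure_level_le (μ := volume.restrict S) (G := G) hvm hmono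
                (b := fun i => b (i + J + i₀)) (s₀ + 1)
                ((ae_restrict_mem measurableSet_closedBall).mono fun y hy i => hvG y hy _)
                (Finset.range k)
              have hidx : ∀ i, i + (s₀ + 1) + J + i₀ = i + J + i₀ + (s₀ + 1) := fun i => by omega
              simp only [hidx] at this
              exact this
      · exact div_nonneg (by linarith) (by linarith)
      · exact ENNReal.sum_le_tsum (f := fun i => (b (i + J + i₀) ^ (1 / ((n : ℝ) - 1)))⁻¹) _
    have h2 : ∑ i ∈ Finset.range k, ((B * m i) ^ (1 / (n : ℝ))).toReal ≤ ρ / 2 := by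
      rw [← ENNReal.toReal_sum fun i _ => hfin i]
      exact ENNReal.toReal_le_of_le_ofReal (by positivity) h1
    have h3 := sum_geometric_two_le k
    rw [Finset.sum_add_distrib, ← Finset.mul_sum]
    nlinarith
  have hchain : ∀ k, ∃ y, dist y x ≤ ∑ i ∈ Finset.range k, R i ∧ a (k + J + i₀ + s₀) ≤ v y := by
    intro k
    induction k with
    | zero => exact ⟨x, by simp, by simpa using hlt.le⟩
    | succ k ih =>
      obtain ⟨y, hy, hvy⟩ := ih
      have hsub : closedBall y (R k) ⊆ S := by
        refine closedBall_subset_closedBall' ?_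
        have h1 := hsumR (k + 1)
        rw [Finset.sum_range_succ] at h1
        have h2 := dist_triangle y x x₀
        have h3 := mem_closedBall.mp hx
        linarith
      obtain ⟨z, hz, hvz⟩ := (hv.mono (closedBall_subset_closedBall (by linarith))
        : SubMeanValueOn K v S).exists_ge_of_measure_lt
        (α := a (k + J + i₀)) (β := a (k + J + i₀ + s₀)) (γ := a (k + J + i₀ + (s₀ + 1))) (C := C)
        (haK _ (by omega)) (haC _)
        ((pos_iff_ne_zero.mpr ha0).trans_le (ha.monotone zero_le)).ne'
        ((ha (Nat.lt_succ_self _)).trans_le le_top).ne (hRpos k) hvy hsub (by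
          change 2 * K * C * m k < _
          rw [Measure.addHaar_ball_of_pos _ _ (hRpos k), finrank_euclideanSpace_fin,
            ← ENNReal.div_lt_iff (Or.inl hV0) (Or.inl hVt)]
          have h1 : (B * m k) ^ (1 / (n : ℝ)) < ENNReal.ofReal (R k) := by
            rw [ENNReal.lt_ofReal_iff_toReal_lt (hfin k)]
            have : 0 < ρ / 4 * (1 / 2) ^ k := by positivity
            simp only [hRdef]
            linarith
          have h2 := ENNReal.rpow_lt_rpow h1 (show (0 : ℝ) < n by linarith)
          rw [← ENNReal.rpow_mul, one_div_mul_cancel (by linarith), ENNReal.rpow_one,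
            ENNReal.rpow_natCast, ← ENNReal.ofReal_pow (hRpos k).le] at h2
          refine lt_of_eq_of_lt ?_ h2
          simp only [hBdef, div_eq_mul_inv]
          ring)
      refine ⟨z, ?_, ?_⟩
      · rw [Finset.sum_range_succ]
        have := dist_triangle z y x
        have := mem_ball.mp hz
        linarith
      · convert hvz using 2
        omega
  have hbound : ∀ y ∈ S, v y ≤ K / volume (ball x₀ ρ) * ∫⁻ y in closedBall x₀ (3 * ρ), v y := by
    intro y hy
    have hy' := mem_closedBall.mp hy
    have hsub : closedBall y ρ ⊆ closedBall x₀ (3 * ρ) :=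
      closedBall_subset_closedBall' (by linarith)
    refine (hv y ρ hρ hsub).trans ?_
    rw [Measure.addHaar_ball_of_pos _ y hρ, Measure.addHaar_ball_of_pos _ x₀ hρ]
    gcongr
    exact ball_subset_closedBall.trans hsub
  obtain ⟨k, hk⟩ := ha_unb (K / volume (ball x₀ ρ) * ∫⁻ y in closedBall x₀ (3 * ρ), v y)
    (ENNReal.mul_ne_top (ENNReal.div_ne_top hK (measure_ball_pos _ _ hρ).ne') hvint)
  obtain ⟨y, hy, hvy⟩ := hchain k
  have hyS : y ∈ S := mem_closedBall.mpr (by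
    have := dist_triangle y x x₀
    have := mem_closedBall.mp hx
    have := hsumR k
    linarith)
  exact absurd ((ha.monotone (by omega)).trans (hvy.trans (hbound y hyS))) (not_le.mpr hk)

end LocalBoundedness

section UpperRegularization

lemma le_coe_toENNReal (x : EReal) : x ≤ (x.toENNReal : EReal) := by
  rcases le_total x 0 with h | h
  · exact h.trans (EReal.coe_ennreal_nonneg _)
  · exact (EReal.coe_toENNReal h).ge

/-- The upper regularization `x ↦ limsup_{y → x} f y` is upper semicontinuous. -/
lemma upperSemicontinuousOn_limsup_nhdsWithin {X : Type*} [TopologicalSpace X] {D : Set X}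
    (hD : IsOpen D) (f : X → EReal) :
    UpperSemicontinuousOn (fun x => limsup f (nhdsWithin x D)) D := by
  intro x hx c hc
  obtain ⟨c', h1, h2⟩ := exists_between hc
  have h3 : ∀ᶠ y in nhdsWithin x D, f y < c' := eventually_lt_of_limsup_lt h1
  rw [hD.nhdsWithin_eq hx] at h3 ⊢
  filter_upwards [h3.eventually_nhds, hD.mem_nhds hx] with y hy hyD
  rw [hD.nhdsWithin_eq hyD]
  exact (limsup_le_of_le (h := hy.mono fun z hz => hz.le)).trans_lt h2

variable {n : ℕ} {D : Set (EuclideanSpace ℝ (Fin n))}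

lemma QNSubharmonicOn.subMeanValueOn {K : ℝ} {u : EuclideanSpace ℝ (Fin n) → EReal}
    (hu : QNSubharmonicOn K u D) :
    SubMeanValueOn (ENNReal.ofReal K) (fun x => (u x).toENNReal) D := by
  intro x r hr hx
  have hpos : ∀ z : EReal, (z ⊔ 0).toENNReal = z.toENNReal := fun z => by
    rcases le_total z 0 with h | h
    · rw [sup_eq_right.mpr h, EReal.toENNReal_of_nonpos h, EReal.toENNReal_zero]
    · rw [sup_eq_left.mpr h]
  have h := hu.2.2.2 0 le_rfl x r hr hx
  simpa [erealPos_eq_toENNReal, hpos, ofReal_div_nuBall_eq hr x] using h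

/-- The upper regularization of a supremum of nonnegative functions satisfying the
sub-mean-value inequality satisfies it as well. -/
lemma subMeanValueOn_limsup_iSup (hD : IsOpen D) {K : ℝ≥0∞} (hK : K ≠ ⊤)
    {𝓕 : Set (EuclideanSpace ℝ (Fin n) → EReal)}
    (h𝓕 : ∀ u ∈ 𝓕, SubMeanValueOn K (fun x => (u x).toENNReal) D) :
    SubMeanValueOn K
      (fun x => (limsup (fun y => ⨆ u ∈ 𝓕, (u y ⊔ 0)) (nhdsWithin x D)).toENNReal) D := by
  intro x r hr hx
  set W : EuclideanSpace ℝ (Fin n) → EReal := fun y => ⨆ u ∈ 𝓕, (u y ⊔ 0)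
  set I := ∫⁻ y in ball x r, (limsup W (nhdsWithin y D)).toENNReal
  have hxD : x ∈ D := hx (mem_closedBall_self hr.le)
  have hle : ∀ u ∈ 𝓕, ∀ y ∈ D, u y ≤ limsup W (nhdsWithin y D) := by
    intro u hu y hy
    have h1 : W y ≤ limsup W (nhdsWithin y D) := by
      rw [hD.nhdsWithin_eq hy]
      refine le_limsup_of_frequently_le ?_
      intro hev
      exact hev.self_of_nhds le_rfl
    exact le_sup_left.trans ((le_iSup₂ (f := fun u (_ : u ∈ 𝓕) => u y ⊔ 0) u hu).trans h1)
  have hvol : ∀ ρ, 0 < ρ → ∀ y : EuclideanSpace ℝ (Fin n),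
      volume (ball y ρ) = ENNReal.ofReal (ρ ^ n) * volume (ball (0 : EuclideanSpace ℝ (Fin n)) 1) :=
    fun ρ hρ y => by
      rw [Measure.addHaar_ball_of_pos _ _ hρ, finrank_euclideanSpace_fin]
  have hstep : ∀ ρ ∈ Ioo 0 r, (limsup W (nhdsWithin x D)).toENNReal ≤
      K / (ENNReal.ofReal (ρ ^ n) * volume (ball (0 : EuclideanSpace ℝ (Fin n)) 1)) * I := by
    intro ρ hρ
    refine (EReal.toENNReal_le_toENNReal ?_).trans_eq EReal.toENNReal_coe
    rw [hD.nhdsWithin_eq hxD]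
    refine limsup_le_of_le (h := ?_)
    filter_upwards [ball_mem_nhds x (sub_pos.mpr hρ.2)] with y hy
    have hy' := mem_ball.mp hy
    refine iSup₂_le fun u hu => sup_le ?_ (EReal.coe_ennreal_nonneg _)
    have hsub : closedBall y ρ ⊆ closedBall x r := closedBall_subset_closedBall' (by linarith)
    have hsub' : ball y ρ ⊆ ball x r := ball_subset_ball' (by linarith)
    have h1 := h𝓕 u hu y ρ hρ.1 (hsub.trans hx)
    rw [hvol ρ hρ.1] at h1
    refine (le_coe_toENNReal _).trans (EReal.coe_ennreal_le_coe_ennreal_iff.mpr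
      (h1.trans ?_))
    gcongr
    refine (setLIntegral_mono' measurableSet_ball fun z hz => ?_).trans (lintegral_mono_set hsub')
    exact EReal.toENNReal_le_toENNReal
      (hle u hu z (hx (ball_subset_closedBall (hsub' hz))))
  have hV0 : volume (ball (0 : EuclideanSpace ℝ (Fin n)) 1) ≠ 0 :=
    (measure_ball_pos _ _ one_pos).ne'
  have hVt : volume (ball (0 : EuclideanSpace ℝ (Fin n)) 1) ≠ ⊤ := measure_ball_lt_top.ne
  by_cases hK0 : K = 0
  · simpa [hK0] using hstep (r / 2) ⟨by linarith, by linarith⟩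
  have hlim : Tendsto (fun ρ : ℝ =>
      K / (ENNReal.ofReal (ρ ^ n) * volume (ball (0 : EuclideanSpace ℝ (Fin n)) 1)) * I)
      (nhdsWithin r (Iio r)) (nhds (K / volume (ball x r) * I)) := by
    rw [hvol r hr x]
    have hr0 : ENNReal.ofReal (r ^ n) ≠ 0 := by
      simpa using pow_pos hr n
    have h1 : Tendsto (fun ρ : ℝ => ENNReal.ofReal (ρ ^ n)) (nhdsWithin r (Iio r))
        (nhds (ENNReal.ofReal (r ^ n))) :=
      ((ENNReal.continuous_ofReal.comp (continuous_pow n)).tendsto r).mono_left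
        nhdsWithin_le_nhds
    have h2 := ENNReal.Tendsto.mul_const (b := volume (ball (0 : EuclideanSpace ℝ (Fin n)) 1)) h1
      (Or.inr hVt)
    have h3 := ENNReal.Tendsto.const_div (a := K) h2 (Or.inr hK)
    refine ENNReal.Tendsto.mul_const h3 (Or.inl ?_)
    exact (ENNReal.div_pos hK0 (by finiteness)).ne'
  refine ge_of_tendsto hlim ?_
  filter_upwards [Ioo_mem_nhdsLT hr] with ρ hρ
  exact hstep ρ hρ

/-- Quasinearly subharmonicity of a nonnegative upper semicontinuous function. -/
lemma qnSubharmonicOn_of_subMeanValueOn {K : ℝ} (hK : 1 ≤ K)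
    {w : EuclideanSpace ℝ (Fin n) → EReal} (hw : UpperSemicontinuousOn w D)
    (hw0 : ∀ x ∈ D, 0 ≤ w x) (hwt : ∀ x ∈ D, w x < ⊤)
    (hmean : SubMeanValueOn (ENNReal.ofReal K) (fun x => (w x).toENNReal) D) :
    QNSubharmonicOn K w D := by
  refine ⟨?_, hwt, ?_, ?_⟩
  · exact (upperSemicontinuousOn_iff_restrict.mpr hw).measurable
  · intro E hE hEc
    rcases E.eq_empty_or_nonempty with rfl | hne
    · simp
    obtain ⟨x, hxE, hx⟩ := (hw.mono hE).exists_isMaxOn hne hEc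
    have h1 : (w x).toENNReal < ⊤ := by
      rw [lt_top_iff_ne_top, EReal.toENNReal_ne_top_iff]
      exact (hwt x (hE hxE)).ne
    calc ∫⁻ y in E, erealPos (w y) ≤ ∫⁻ _ in E, (w x).toENNReal :=
          setLIntegral_mono' hEc.measurableSet fun y hy => EReal.toENNReal_le_toENNReal (hx hy)
      _ = (w x).toENNReal * volume E := setLIntegral_const _ _
      _ < ⊤ := ENNReal.mul_lt_top h1 hEc.measure_lt_top
  · intro M hM x r hr hx
    have hadd : ∀ y ∈ D, erealPos ((w y ⊔ ((-M : ℝ) : EReal)) + ((M : ℝ) : EReal)) =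
        (w y).toENNReal + ENNReal.ofReal M := by
      intro y hy
      have h1 : ((-M : ℝ) : EReal) ≤ w y :=
        le_trans (by exact_mod_cast (neg_nonpos.mpr hM)) (hw0 y hy)
      rw [sup_eq_left.mpr h1, erealPos_eq_toENNReal,
        EReal.toENNReal_add (hw0 y hy) (by exact_mod_cast hM),
        EReal.toENNReal_of_ne_top (x := (M : EReal)) (EReal.coe_ne_top M), EReal.toReal_coe]
    rw [hadd x (hx (mem_closedBall_self hr.le)), setLIntegral_congr_fun measurableSet_ball
      fun y hy => hadd y (hx (ball_subset_closedBall hy)), lintegral_add_right _ measurable_const,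
      setLIntegral_const, mul_add, ofReal_div_nuBall_eq hr x]
    refine add_le_add (hmean x r hr hx) ?_
    calc ENNReal.ofReal M = 1 * ENNReal.ofReal M := (one_mul _).symm
      _ ≤ ENNReal.ofReal K * ENNReal.ofReal M := by
          gcongr
          simpa using hK
      _ = ENNReal.ofReal K / volume (ball x r) * (ENNReal.ofReal M * volume (ball x r)) := by
          rw [mul_comm (ENNReal.ofReal M), ← mul_assoc,
            ENNReal.div_mul_cancel (measure_ball_pos _ _ hr).ne' measure_ball_lt_top.ne]

end UpperRegularization

/-- The integral test, with upper cells. -/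
lemma tsum_le_lintegral_Ioi_of_antitone {f : ℝ → ℝ≥0∞} (hf : Antitone f) (c : ℝ) :
    ∑' i : ℕ, f (c + (i + 1)) ≤ ∫⁻ s in Ioi c, f s := by
  have hmono : Monotone fun i : ℕ => c + (i : ℝ) := fun i j hij => by
    simpa using hij
  have hdisj : Pairwise (Function.onFun Disjoint fun i : ℕ => Ioc (c + (i : ℝ)) (c + (i + 1))) := by
    have := hmono.pairwise_disjoint_on_Ioc_succ
    simpa using this
  calc ∑' i : ℕ, f (c + (i + 1))
      ≤ ∑' i : ℕ, ∫⁻ s in Ioc (c + (i : ℝ)) (c + (i + 1)), f s := by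
        refine ENNReal.tsum_le_tsum fun i => ?_
        calc f (c + (i + 1)) = ∫⁻ _ in Ioc (c + (i : ℝ)) (c + (i + 1)), f (c + (i + 1)) := by
              simp
          _ ≤ ∫⁻ s in Ioc (c + (i : ℝ)) (c + (i + 1)), f s :=
              setLIntegral_mono' measurableSet_Ioc fun s hs => hf hs.2
    _ = ∫⁻ s in ⋃ i : ℕ, Ioc (c + (i : ℝ)) (c + (i + 1)), f s :=
        (lintegral_iUnion (fun _ => measurableSet_Ioc) hdisj _).symm
    _ ≤ ∫⁻ s in Ioi c, f s := by
        refine lintegral_mono_set (iUnion_subset fun i s hs => ?_)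
        have : (0 : ℝ) ≤ i := i.cast_nonneg
        exact mem_Ioi.mpr (by linarith [hs.1])

lemma le_logPlusE {i : ℕ} {t : ℝ≥0∞} (h : ENNReal.ofReal (Real.exp i) ≤ t) :
    (i : ℝ≥0∞) ≤ logPlusE t := by
  unfold logPlusE
  split_ifs with ht
  · exact le_top
  · rw [← ENNReal.ofReal_natCast]
    refine ENNReal.ofReal_le_ofReal ?_
    have h1 := (ENNReal.ofReal_le_iff_le_toReal ht).mp h
    exact (Real.le_log_iff_exp_le ((Real.exp_pos _).trans_le h1)).mpr h1

theorem remark_delta2_condition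
    (n : ℕ) (hn : 2 ≤ n)
    (D : Set (EuclideanSpace ℝ (Fin n))) (hDopen : IsOpen D) (hDconn : IsConnected D)
    (K : ℝ) (hK : 1 ≤ K)
    (φ : ℝ≥0∞ → ℝ≥0∞) (hφ : StrictMono φ)
    (s₀ s₁ : ℕ) (hs : s₀ < s₁)
    (hiv : ∫⁻ s in Set.Ioi ((s₁ : ℝ)),
      (φ (ENNReal.ofReal (s - (s₀ : ℝ))) ^ (1 / ((n : ℝ) - 1)))⁻¹ < ⊤)
    (ϕ ϕinv : ℝ≥0∞ → ℝ≥0∞) (hϕ : StrictMono ϕ)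
    (hϕinv₁ : Function.LeftInverse ϕinv ϕ) (hϕinv₂ : Function.RightInverse ϕinv ϕ)
    (hΔ₂ : ∃ C : ℝ≥0∞, C ≠ ⊤ ∧ ∀ t : ℝ≥0∞, ϕinv (2 * t) ≤ C * ϕinv t)
    (hb : ∀ s : ℝ, (s₁ : ℝ) ≤ s →
      ENNReal.ofReal (2 * K) * ϕinv (ENNReal.ofReal (Real.exp (s - (s₀ : ℝ)))) ≤
        ϕinv (ENNReal.ofReal (Real.exp s)))
    (ψ : ℝ≥0∞ → ℝ≥0∞) (hψdef : ∀ t, ψ t = φ (logPlusE (ϕ t)))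
    (F : EuclideanSpace ℝ (Fin n) → ℝ≥0∞) (hFmeas : Measurable (D.restrict F))
    (𝓕 : Set (EuclideanSpace ℝ (Fin n) → EReal)) (h𝓕ne : 𝓕.Nonempty)
    (h𝓕 : ∀ u ∈ 𝓕, QNSubharmonicOn K u D ∧ ∀ x ∈ D, u x ≤ ((F x : ℝ≥0∞) : EReal))
    (hint : ∀ E ⊆ D, IsCompact E → ∫⁻ x in E, ψ (F x) < ⊤) :
    (∀ x ∈ D, ∃ r > (0 : ℝ), ∃ C : ℝ, ∀ y ∈ closedBall x r ∩ D, ∀ u ∈ 𝓕, u y ≤ (C : EReal)) ∧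
    (∀ x ∈ D, 0 ≤ Filter.limsup (fun y => ⨆ u ∈ 𝓕, (u y ⊔ 0)) (nhdsWithin x D)) ∧
    QNSubharmonicOn K (fun x => Filter.limsup (fun y => ⨆ u ∈ 𝓕, (u y ⊔ 0)) (nhdsWithin x D)) D := by
  have hϕinv : StrictMono ϕinv := fun s t hst => by
    rwa [← hϕ.lt_iff_lt, hϕinv₂, hϕinv₂]
  obtain ⟨C, hC, hΔ⟩ := hΔ₂
  set a : ℕ → ℝ≥0∞ := fun i => ϕinv (ENNReal.ofReal (Real.exp i)) with hadef
  have ha : StrictMono a := fun i j hij => hϕinv <|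
    (ENNReal.ofReal_lt_ofReal_iff (Real.exp_pos _)).mpr (Real.exp_lt_exp.mpr (by exact_mod_cast hij))
  have ha0 : a 0 ≠ 0 := by
    refine ne_bot_of_gt (hϕinv (a := 0) ?_)
    simp
  have ha_top : ∀ i, a i ≠ ⊤ := fun i => ((ha (Nat.lt_succ_self i)).trans_le le_top).ne
  have ha_unb : ∀ B, B ≠ ⊤ → ∃ i, B < a i := by
    intro B hB
    have h1 : ϕ B ≠ ⊤ := ((hϕ (lt_top_iff_ne_top.mpr hB)).trans_le le_top).ne
    obtain ⟨i, hi⟩ := exists_nat_gt (ϕ B).toReal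
    refine ⟨i, ?_⟩
    rw [← hϕ.lt_iff_lt]
    simp only [hadef]
    rw [hϕinv₂, ENNReal.lt_ofReal_iff_toReal_lt h1]
    linarith [Real.add_one_le_exp (i : ℝ)]
  set i₀ := s₁ - s₀ + 1 with hi₀
  have haK : ∀ i, i₀ ≤ i → 2 * ENNReal.ofReal K * a i ≤ a (i + s₀) := by
    intro i hi
    have h1 := hb (i + s₀ : ℕ) (by exact_mod_cast (by omega : s₁ ≤ i + s₀))
    rw [ENNReal.ofReal_mul (by norm_num)] at h1
    simpa [hadef] using h1
  have haC : ∀ i, a (i + 1) ≤ C ^ 2 * a i := by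
    intro i
    calc a (i + 1) ≤ ϕinv (2 * (2 * ENNReal.ofReal (Real.exp i))) := by
          refine hϕinv.monotone ?_
          have h1 : (2 : ℝ≥0∞) = ENNReal.ofReal 2 := by simp
          rw [h1, ← ENNReal.ofReal_mul (by norm_num), ← ENNReal.ofReal_mul (by norm_num)]
          refine ENNReal.ofReal_le_ofReal ?_
          push_cast
          rw [Real.exp_add]
          nlinarith [Real.exp_one_lt_d9, Real.exp_pos (i : ℝ)]
      _ ≤ C * (C * a i) := (hΔ _).trans (by gcongr; exact hΔ _)
      _ = C ^ 2 * a i := by ring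
  set b : ℕ → ℝ≥0∞ := fun i => φ i with hbdef
  have hb0 : ∀ i, i₀ ≤ i → b i ≠ 0 := fun i hi =>
    ne_bot_of_gt (hφ (a := 0) (by exact_mod_cast (by omega : 0 < i)))
  have hbt : ∀ i, b i ≠ ⊤ := fun i => ((hφ (ENNReal.natCast_lt_top i)).trans_le le_top).ne
  have hn' : (2 : ℝ) ≤ n := by exact_mod_cast hn
  have hsum : ∑' i, (b (i + i₀) ^ (1 / ((n : ℝ) - 1)))⁻¹ ≠ ⊤ := by
    have hanti : Antitone fun s : ℝ =>
        (φ (ENNReal.ofReal (s - (s₀ : ℝ))) ^ (1 / ((n : ℝ) - 1)))⁻¹ := fun s t hst =>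
      ENNReal.inv_le_inv.mpr (ENNReal.rpow_le_rpow
        (hφ.monotone (ENNReal.ofReal_le_ofReal (by linarith)))
        (div_nonneg zero_le_one (by linarith)))
    refine ne_top_of_le_ne_top hiv.ne (le_trans (le_of_eq ?_)
      (tsum_le_lintegral_Ioi_of_antitone hanti s₁))
    refine tsum_congr fun i => ?_
    simp only [hbdef]
    rw [← ENNReal.ofReal_natCast]
    congr 4
    rw [hi₀]
    push_cast [Nat.cast_sub hs.le]
    ring
  have hψ : ∀ i f, a i ≤ f → b i ≤ ψ f := by
    intro i f hf
    rw [hψdef]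
    refine hφ.monotone (le_logPlusE ?_)
    rw [← hϕinv.le_iff_le, hϕinv₁]
    exact hf
  have hbdd : ∀ x ∈ D, ∃ r > (0 : ℝ), ∃ C : ℝ,
      ∀ y ∈ closedBall x r, ∀ u ∈ 𝓕, u y ≤ (C : EReal) := by
    intro x hx
    obtain ⟨ε, hε, hεD⟩ := Metric.nhds_basis_closedBall.mem_iff.mp (hDopen.mem_nhds hx)
    have hρ : 0 < ε / 3 := by positivity
    have h3 : closedBall x (3 * (ε / 3)) ⊆ D := by
      rwa [mul_div_cancel₀ _ (by norm_num)]
    have h2 : closedBall x (2 * (ε / 3)) ⊆ D :=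
      (closedBall_subset_closedBall (by linarith)).trans h3
    obtain ⟨J, hJ⟩ := exists_uniform_bound hn (K := ENNReal.ofReal K) ENNReal.ofReal_ne_top
      (ENNReal.pow_ne_top hC) ha ha0 ha_unb haK haC hb0 hbt hsum (G := fun y => ψ (F y)) hρ
      (hint _ h2 (isCompact_closedBall _ _)).ne
    refine ⟨ε / 3, hρ, (a J).toReal, fun y hy u hu => ?_⟩
    obtain ⟨hqn, huF⟩ := h𝓕 u hu
    have h := hJ (fun y => (u y).toENNReal) (hqn.subMeanValueOn.mono h3)
      (hqn.2.2.1 _ h3 (isCompact_closedBall _ _)).ne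
      ((aemeasurable_restrict_of_measurable_subtype hDopen.measurableSet
        hqn.1.ereal_toENNReal).mono_measure (Measure.restrict_mono h2 le_rfl))
      (fun z hz i hi => hψ i _ (hi.trans
        ((EReal.toENNReal_le_toENNReal (huF z (h2 hz))).trans_eq EReal.toENNReal_coe))) y hy
    calc u y ≤ ((u y).toENNReal : EReal) := le_coe_toENNReal _
      _ ≤ ((a J : ℝ≥0∞) : EReal) := EReal.coe_ennreal_le_coe_ennreal_iff.mpr h
      _ = (((a J).toReal : ℝ) : EReal) := (EReal.coe_ennreal_toReal (ha_top J)).symm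
  set w : EuclideanSpace ℝ (Fin n) → EReal :=
    fun x => limsup (fun y => ⨆ u ∈ 𝓕, (u y ⊔ 0)) (nhdsWithin x D) with hw
  have hw0 : ∀ x ∈ D, 0 ≤ w x := by
    intro x hx
    obtain ⟨u, hu⟩ := h𝓕ne
    simp only [hw]
    rw [hDopen.nhdsWithin_eq hx]
    refine le_limsup_of_frequently_le (Eventually.frequently (Eventually.of_forall fun y => ?_))
    exact le_sup_right.trans (le_iSup₂ (f := fun u (_ : u ∈ 𝓕) => u y ⊔ 0) u hu)
  have hwt : ∀ x ∈ D, w x < ⊤ := by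
    intro x hx
    obtain ⟨r, hr, C, hC⟩ := hbdd x hx
    refine lt_of_le_of_lt ?_ (EReal.coe_lt_top (max C 0))
    simp only [hw]
    rw [hDopen.nhdsWithin_eq hx]
    refine limsup_le_of_le (h := ?_)
    filter_upwards [closedBall_mem_nhds x hr] with y hy
    refine iSup₂_le fun u hu => sup_le ((hC y hy u hu).trans ?_) ?_
    · exact_mod_cast le_max_left C 0
    · exact_mod_cast le_max_right C 0
  refine ⟨fun x hx => ?_, hw0, ?_⟩
  · obtain ⟨r, hr, C, hC⟩ := hbdd x hx
    exact ⟨r, hr, C, fun y hy => hC y hy.1⟩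
  · exact qnSubharmonicOn_of_subMeanValueOn hK
      (upperSemicontinuousOn_limsup_nhdsWithin hDopen _) hw0 hwt
      (subMeanValueOn_limsup_iSup hDopen ENNReal.ofReal_ne_top
        fun u hu => (h𝓕 u hu).1.subMeanValueOn)
end
end
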